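/- arXiv:2102.07732 — 4 statements merged into one kernel-verified Lean document; each statement's English description precedes it below -/
import Mathlib

section
/- Let {(p_x, ρ_x)}_{x∈Ω} be a finite ensemble of density matrices on ℂ^n (p_x ≥ 0, ∑_x p_x = 1) and let Λ be a quantum channel in Kraus form from n×n to m×m complex matrices. Then the Holevo quantity is non-increasing under the action of Λ: S(∑_x p_x Λ(ρ_x)) − ∑_x p_x S(Λ(ρ_x)) ≤ S(∑_x p_x ρ_x) − ∑_x p_x S(ρ_x). -/
open Matrix BigOperators Kronecker
open scoped ComplexOrder

/-- Von Neumann entropy `S(ρ) = -∑ λᵢ ln λᵢ` of a matrix, via the eigenvalues of a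
Hermitian matrix (junk value `0` if `ρ` is not Hermitian). Note `0 * Real.log 0 = 0`. -/
noncomputable def vNE {n : Type*} [Fintype n] [DecidableEq n] (ρ : Matrix n n ℂ) : ℝ :=
  if h : ρ.IsHermitian then -∑ i, (h.eigenvalues i) * Real.log (h.eigenvalues i) else 0

/-- Lüders channel `N_P(ρ) = ∑ⱼ Pⱼ ρ Pⱼ` of a family of projections `P`. -/
noncomputable def luders {n ι : Type*} [Fintype ι] [Fintype n] (P : ι → Matrix n n ℂ)
    (ρ : Matrix n n ℂ) : Matrix n n ℂ :=
  ∑ j, P j * ρ * P j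

section Helpers
open Filter Topology

variable {n m ι : Type*} [Fintype n] [DecidableEq n] [Fintype m] [DecidableEq m] [Fintype ι]

noncomputable def GG (ρ σ : Matrix n n ℂ) (t : ℝ) (X : Matrix n n ℂ) : ℝ :=
  2 * (Xᴴ * ρ).trace.re - (Xᴴ * σ * X).trace.re - t * (X * ρ * Xᴴ).trace.re

noncomputable def ff (U V : Matrix n n ℂ) (l u : n → ℝ) (t : ℝ) : ℝ :=
  ∑ j, ∑ i, Complex.normSq ((Vᴴ * U) j i) * (l i ^ 2 / (u j + t * l i))

noncomputable def Phi (U V : Matrix n n ℂ) (l u : n → ℝ) (t : ℝ) : ℝ :=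
  ∑ j, ∑ i, Complex.normSq ((Vᴴ * U) j i) * l i * (Real.log (u j + t * l i) - Real.log (u j))

noncomputable def dg (U : Matrix n n ℂ) (l : n → ℝ) : Matrix n n ℂ :=
  U * diagonal (fun i => (l i : ℂ)) * Uᴴ

lemma tr_quad (Y : Matrix n n ℂ) (u : n → ℝ) :
    (Yᴴ * diagonal (fun i => (u i : ℂ)) * Y).trace.re = ∑ j, ∑ i, u j * Complex.normSq (Y j i) := by
  rw [Matrix.trace, Finset.sum_comm, Complex.re_sum]
  refine Finset.sum_congr rfl fun i _ => ?_
  rw [Matrix.diag_apply, Matrix.mul_apply, Complex.re_sum]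
  refine Finset.sum_congr rfl fun j _ => ?_
  rw [Matrix.mul_diagonal, Matrix.conjTranspose_apply]
  simp [Complex.normSq_apply]
  ring

lemma tr_quad' (Y : Matrix n n ℂ) (l : n → ℝ) :
    (Y * diagonal (fun i => (l i : ℂ)) * Yᴴ).trace.re = ∑ j, ∑ i, l i * Complex.normSq (Y j i) := by
  rw [Matrix.trace, Complex.re_sum]
  refine Finset.sum_congr rfl fun i _ => ?_
  rw [Matrix.diag_apply, Matrix.mul_apply, Complex.re_sum]
  refine Finset.sum_congr rfl fun j _ => ?_
  rw [Matrix.mul_diagonal, Matrix.conjTranspose_apply]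
  simp [Complex.normSq_apply]
  ring

lemma tr_lin (Y W : Matrix n n ℂ) (l : n → ℝ) :
    (Yᴴ * (W * diagonal (fun i => (l i : ℂ)))).trace.re
      = ∑ j, ∑ i, l i * (star (Y j i) * W j i).re := by
  rw [Matrix.trace, Finset.sum_comm, Complex.re_sum]
  refine Finset.sum_congr rfl fun i _ => ?_
  rw [Matrix.diag_apply, Matrix.mul_apply, Complex.re_sum]
  refine Finset.sum_congr rfl fun j _ => ?_
  rw [Matrix.mul_diagonal, Matrix.conjTranspose_apply]
  simp
  ring

lemma GG_eq (U V : Matrix n n ℂ) (l u : n → ℝ) (hU : Uᴴ * U = 1) (hV : Vᴴ * V = 1)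
    (t : ℝ) (Y : Matrix n n ℂ) :
    GG (dg U l) (dg V u) t (V * Y * Uᴴ) = ∑ j, ∑ i,
      (2 * (l i * (star (Y j i) * (Vᴴ * U) j i).re) - u j * Complex.normSq (Y j i)
        - t * (l i * Complex.normSq (Y j i))) := by
  have h1 : ((V * Y * Uᴴ)ᴴ * dg U l).trace
      = (Yᴴ * ((Vᴴ * U) * diagonal (fun i => (l i : ℂ)))).trace := by
    have : (V * Y * Uᴴ)ᴴ * dg U l
      = U * (Yᴴ * ((Vᴴ * U) * diagonal (fun i => (l i : ℂ))) * Uᴴ) := by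
      simp [dg, Matrix.mul_assoc]
    rw [this, Matrix.trace_mul_comm, Matrix.mul_assoc, hU, Matrix.mul_one]
  have h2 : ((V * Y * Uᴴ)ᴴ * dg V u * (V * Y * Uᴴ)).trace
      = (Yᴴ * diagonal (fun i => (u i : ℂ)) * Y).trace := by
    have : (V * Y * Uᴴ)ᴴ * dg V u * (V * Y * Uᴴ)
      = U * (Yᴴ * ((Vᴴ * V) * diagonal (fun i => (u i : ℂ)) * (Vᴴ * V)) * Y * Uᴴ) := by
      simp only [dg, Matrix.mul_assoc, Matrix.conjTranspose_mul, Matrix.conjTranspose_conjTranspose]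
    rw [this, Matrix.trace_mul_comm, Matrix.mul_assoc, hU, Matrix.mul_one, hV, Matrix.mul_one,
      Matrix.one_mul]
  have h3 : ((V * Y * Uᴴ) * dg U l * (V * Y * Uᴴ)ᴴ).trace
      = (Y * diagonal (fun i => (l i : ℂ)) * Yᴴ).trace := by
    have : (V * Y * Uᴴ) * dg U l * (V * Y * Uᴴ)ᴴ
      = V * (Y * ((Uᴴ * U) * diagonal (fun i => (l i : ℂ)) * (Uᴴ * U)) * Yᴴ * Vᴴ) := by
      simp only [dg, Matrix.mul_assoc, Matrix.conjTranspose_mul, Matrix.conjTranspose_conjTranspose]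
    rw [this, Matrix.trace_mul_comm, Matrix.mul_assoc, hV, Matrix.mul_one, hU, Matrix.mul_one,
      Matrix.one_mul]
  rw [GG, h1, h2, h3, tr_lin, tr_quad, tr_quad']
  simp only [Finset.mul_sum, Finset.sum_sub_distrib]

lemma GG_le (U V : Matrix n n ℂ) (l u : n → ℝ) (hU : Uᴴ * U = 1) (hV : Vᴴ * V = 1)
    (hl : ∀ i, 0 ≤ l i) (hu : ∀ i, 0 ≤ u i) (t : ℝ) (ht : 0 < t) (X : Matrix n n ℂ) :
    GG (dg U l) (dg V u) t X ≤ ff U V l u t := by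
  have hX : X = V * (Vᴴ * X * U) * Uᴴ := by
    have hU' := mul_eq_one_comm.mp hU
    have hV' := mul_eq_one_comm.mp hV
    calc X = (V * Vᴴ) * X * (U * Uᴴ) := by rw [hU', hV']; simp
      _ = _ := by simp only [Matrix.mul_assoc]
  rw [hX, GG_eq U V l u hU hV]
  refine Finset.sum_le_sum fun j _ => Finset.sum_le_sum fun i _ => ?_
  generalize (Vᴴ * X * U) j i = y
  generalize (Vᴴ * U) j i = w
  rcases (hl i).eq_or_lt with h | h
  · rw [← h]
    have := mul_nonneg (hu j) (Complex.normSq_nonneg y)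
    simp; linarith
  · have hd : 0 < u j + t * l i := add_pos_of_nonneg_of_pos (hu j) (by positivity)
    rw [← mul_div_assoc, le_div_iff₀ hd]
    simp only [Complex.normSq_apply, Complex.star_def, Complex.mul_re, Complex.conj_re,
      Complex.conj_im]
    nlinarith [sq_nonneg ((u j + t * l i) * y.re - l i * w.re),
      sq_nonneg ((u j + t * l i) * y.im - l i * w.im)]

lemma GG_ex (U V : Matrix n n ℂ) (l u : n → ℝ) (hU : Uᴴ * U = 1) (hV : Vᴴ * V = 1)
    (hl : ∀ i, 0 ≤ l i) (hu : ∀ i, 0 ≤ u i) (t : ℝ) (ht : 0 < t) :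
    ∃ X, GG (dg U l) (dg V u) t X = ff U V l u t := by
  refine ⟨V * (Matrix.of fun j i => ((l i / (u j + t * l i) : ℝ) : ℂ) * (Vᴴ * U) j i) * Uᴴ, ?_⟩
  rw [GG_eq U V l u hU hV]
  refine Finset.sum_congr rfl fun j _ => Finset.sum_congr rfl fun i _ => ?_
  rw [Matrix.of_apply]
  generalize (Vᴴ * U) j i = w
  rcases (hl i).eq_or_lt with h | h
  · rw [← h]; simp
  · have hd : 0 < u j + t * l i := add_pos_of_nonneg_of_pos (hu j) (by positivity)
    have hc : l i / (u j + t * l i) * (u j + t * l i) = l i := div_mul_cancel₀ _ hd.ne'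
    have h2 : l i ^ 2 / (u j + t * l i) = l i * (l i / (u j + t * l i)) := by ring
    rw [h2]
    generalize l i / (u j + t * l i) = c at *
    rw [Complex.normSq_mul, Complex.normSq_ofReal]
    simp only [Complex.normSq_apply, Complex.star_def, Complex.mul_re, Complex.conj_re,
      Complex.conj_im, Complex.mul_im, Complex.ofReal_re, Complex.ofReal_im]
    linear_combination (-c * (w.re * w.re + w.im * w.im)) * hc

lemma schwarz (K : ι → Matrix m n ℂ) (hK : ∑ i, (K i)ᴴ * K i = 1) (σ : Matrix n n ℂ)
    (hσ : σ.PosSemidef) (X : Matrix m m ℂ) :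
    ((∑ i, (K i)ᴴ * X * K i)ᴴ * σ * (∑ i, (K i)ᴴ * X * K i)).trace.re
      ≤ (Xᴴ * (∑ i, K i * σ * (K i)ᴴ) * X).trace.re := by
  set Y := ∑ i, (K i)ᴴ * X * K i with hY
  have hYh : Yᴴ = ∑ i, (K i)ᴴ * Xᴴ * K i := by
    simp [hY, Matrix.conjTranspose_sum, Matrix.mul_assoc]
  have h0 : 0 ≤ ∑ i, (((K i)ᴴ * X - Y * (K i)ᴴ)ᴴ * σ * ((K i)ᴴ * X - Y * (K i)ᴴ)).trace :=
    Finset.sum_nonneg fun i _ => (hσ.conjTranspose_mul_mul_same _).trace_nonneg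
  have h1 : ∑ i, (((K i)ᴴ * X - Y * (K i)ᴴ)ᴴ * σ * ((K i)ᴴ * X - Y * (K i)ᴴ)).trace
      = (Xᴴ * (∑ i, K i * σ * (K i)ᴴ) * X).trace - (Yᴴ * σ * Y).trace := by
    have e : ∀ i, (((K i)ᴴ * X - Y * (K i)ᴴ)ᴴ * σ * ((K i)ᴴ * X - Y * (K i)ᴴ)).trace
      = (Xᴴ * (K i * σ * (K i)ᴴ) * X).trace - (Yᴴ * σ * ((K i)ᴴ * X * K i)).trace
        - (((K i)ᴴ * Xᴴ * K i) * (σ * Y)).trace + (Yᴴ * σ * Y * ((K i)ᴴ * K i)).trace := by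
      intro i
      have a : (Yᴴ * σ * ((K i)ᴴ * X * K i)).trace = (K i * Yᴴ * σ * (K i)ᴴ * X).trace := by
        rw [← Matrix.mul_assoc, Matrix.trace_mul_comm]; simp only [Matrix.mul_assoc]
      have b : (((K i)ᴴ * Xᴴ * K i) * (σ * Y)).trace = (Xᴴ * K i * σ * Y * (K i)ᴴ).trace := by
        rw [Matrix.mul_assoc, Matrix.mul_assoc, Matrix.trace_mul_comm]
        simp only [Matrix.mul_assoc]
      have c : (Yᴴ * σ * Y * ((K i)ᴴ * K i)).trace = (K i * Yᴴ * σ * Y * (K i)ᴴ).trace := by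
        rw [← Matrix.mul_assoc, Matrix.trace_mul_comm]; simp only [Matrix.mul_assoc]
      rw [a, b, c, ← Matrix.trace_sub, ← Matrix.trace_sub, ← Matrix.trace_add]
      congr 1
      simp only [Matrix.conjTranspose_sub, Matrix.conjTranspose_mul,
        Matrix.conjTranspose_conjTranspose, Matrix.sub_mul, Matrix.mul_sub, Matrix.mul_assoc]
      abel
    simp only [e, Finset.sum_sub_distrib, Finset.sum_add_distrib, ← Matrix.trace_sum,
      ← Matrix.mul_sum, ← Matrix.sum_mul]
    rw [hK, ← hYh, ← hY, Matrix.mul_one, ← Matrix.mul_assoc Yᴴ σ Y]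
    ring
  rw [h1] at h0
  have := (Complex.le_def.mp h0).1
  simp at this
  exact this

lemma GG_mono (K : ι → Matrix m n ℂ) (hK : ∑ i, (K i)ᴴ * K i = 1) (ρ σ : Matrix n n ℂ)
    (hρ : ρ.PosSemidef) (hσ : σ.PosSemidef) (t : ℝ) (ht : 0 < t) (X : Matrix m m ℂ) :
    GG (∑ i, K i * ρ * (K i)ᴴ) (∑ i, K i * σ * (K i)ᴴ) t X
      ≤ GG ρ σ t (∑ i, (K i)ᴴ * X * K i) := by
  have h1 := schwarz K hK σ hσ X
  have h2 := schwarz K hK ρ hρ Xᴴ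
  have hYh : (∑ i, (K i)ᴴ * X * K i)ᴴ = ∑ i, (K i)ᴴ * Xᴴ * K i := by
    simp [Matrix.conjTranspose_sum, Matrix.mul_assoc]
  rw [← hYh, Matrix.conjTranspose_conjTranspose, Matrix.conjTranspose_conjTranspose] at h2
  have h3 : (Xᴴ * (∑ i, K i * ρ * (K i)ᴴ)).trace
      = ((∑ i, (K i)ᴴ * X * K i)ᴴ * ρ).trace := by
    rw [hYh, Matrix.mul_sum, Matrix.sum_mul, Matrix.trace_sum, Matrix.trace_sum]
    refine Finset.sum_congr rfl fun i _ => ?_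
    rw [← Matrix.mul_assoc, Matrix.trace_mul_comm]
    simp only [Matrix.mul_assoc]
  unfold GG
  rw [h3]
  have := mul_le_mul_of_nonneg_left h2 ht.le
  linarith

lemma Phi_deriv (U V : Matrix n n ℂ) (l u : n → ℝ) (hl : ∀ i, 0 ≤ l i) (hu : ∀ i, 0 ≤ u i)
    (hs : ∀ j i, u j = 0 → Complex.normSq ((Vᴴ * U) j i) * l i = 0) (t : ℝ) (ht : 0 ≤ t) :
    HasDerivAt (Phi U V l u) (ff U V l u t) t := by
  unfold Phi ff
  refine HasDerivAt.fun_sum fun j _ => HasDerivAt.fun_sum fun i _ => ?_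
  rcases (hu j).eq_or_lt with h | h
  · have h0 := hs j i h.symm
    have e : Complex.normSq ((Vᴴ * U) j i) * (l i ^ 2 / (u j + t * l i)) = 0 := by
      rw [pow_two, mul_div_assoc, ← mul_assoc, h0, zero_mul]
    rw [e, h0]
    simpa using hasDerivAt_const t (0:ℝ)
  · have hd : 0 < u j + t * l i := add_pos_of_pos_of_nonneg h (mul_nonneg ht (hl i))
    have h1 : HasDerivAt (fun t => u j + t * l i) (l i) t := by
      simpa using ((hasDerivAt_id t).mul_const (l i)).const_add (u j)
    have h2 := ((h1.log hd.ne').sub_const (Real.log (u j))).const_mul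
      (Complex.normSq ((Vᴴ * U) j i) * l i)
    refine h2.congr_deriv ?_
    ring

lemma Phi_zero (U V : Matrix n n ℂ) (l u : n → ℝ) : Phi U V l u 0 = 0 := by
  simp [Phi]

lemma col_sum (U V : Matrix n n ℂ) (hU : Uᴴ * U = 1) (hV : Vᴴ * V = 1) (i : n) :
    ∑ j, Complex.normSq ((Vᴴ * U) j i) = 1 := by
  have h : (Vᴴ * U)ᴴ * (Vᴴ * U) = 1 := by
    have hV' := mul_eq_one_comm.mp hV
    calc (Vᴴ * U)ᴴ * (Vᴴ * U) = Uᴴ * (V * Vᴴ) * U := by simp [Matrix.mul_assoc]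
      _ = 1 := by rw [hV', Matrix.mul_one, hU]
  have h2 := congrFun (congrFun h i) i
  rw [Matrix.mul_apply, Matrix.one_apply_eq] at h2
  have h3 := congrArg Complex.re h2
  rw [Complex.re_sum] at h3
  simpa [Complex.normSq_apply] using h3

noncomputable def DD (U V : Matrix n n ℂ) (l u : n → ℝ) : ℝ :=
  ∑ i, l i * Real.log (l i) - ∑ j, ∑ i, Complex.normSq ((Vᴴ * U) j i) * l i * Real.log (u j)

lemma sum_w (U V : Matrix n n ℂ) (hU : Uᴴ * U = 1) (hV : Vᴴ * V = 1) (f : n → ℝ) :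
    ∑ i, f i = ∑ j, ∑ i, Complex.normSq ((Vᴴ * U) j i) * f i := by
  rw [Finset.sum_comm]
  refine Finset.sum_congr rfl fun i _ => ?_
  rw [← Finset.sum_mul, col_sum U V hU hV, one_mul]

lemma Phi_lim (U V : Matrix n n ℂ) (l u : n → ℝ) (hU : Uᴴ * U = 1) (hV : Vᴴ * V = 1)
    (hl : ∀ i, 0 ≤ l i) (hu : ∀ i, 0 ≤ u i) :
    Tendsto (fun T => Phi U V l u T - (∑ i, l i) * Real.log T) atTop (𝓝 (DD U V l u)) := by
  have e : ∀ T, Phi U V l u T - (∑ i, l i) * Real.log T = ∑ j, ∑ i,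
      Complex.normSq ((Vᴴ * U) j i) * l i *
        (Real.log (u j + T * l i) - Real.log T - Real.log (u j)) := by
    intro T
    rw [sum_w U V hU hV, Phi, Finset.sum_mul, ← Finset.sum_sub_distrib]
    refine Finset.sum_congr rfl fun j _ => ?_
    rw [Finset.sum_mul, ← Finset.sum_sub_distrib]
    refine Finset.sum_congr rfl fun i _ => ?_
    ring
  have e2 : DD U V l u = ∑ j, ∑ i,
      Complex.normSq ((Vᴴ * U) j i) * l i * (Real.log (l i) - Real.log (u j)) := by
    rw [DD, sum_w U V hU hV, ← Finset.sum_sub_distrib]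
    refine Finset.sum_congr rfl fun j _ => ?_
    rw [← Finset.sum_sub_distrib]
    refine Finset.sum_congr rfl fun i _ => ?_
    ring
  simp only [e]
  rw [e2]
  refine tendsto_finsetSum _ fun j _ => tendsto_finsetSum _ fun i _ => ?_
  rcases (hl i).eq_or_lt with h | h
  · rw [← h]; simp
  · refine Tendsto.const_mul _ (Tendsto.sub_const ?_ _)
    have h1 : Tendsto (fun T : ℝ => u j / T + l i) atTop (𝓝 (l i)) := by
      simpa using (tendsto_const_nhds.div_atTop tendsto_id : Tendsto (fun T : ℝ => u j / T) atTop (𝓝 0)).add_const (l i)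
    refine (h1.log h.ne').congr' ?_
    filter_upwards [eventually_gt_atTop 0] with T hT
    have : u j + T * l i ≠ 0 := (add_pos_of_nonneg_of_pos (hu j) (by positivity)).ne'
    rw [← Real.log_div this hT.ne']
    congr 1
    field_simp

lemma dg_tr (U : Matrix n n ℂ) (l : n → ℝ) (hU : Uᴴ * U = 1) :
    (dg U l).trace.re = ∑ i, l i := by
  rw [dg, Matrix.trace_mul_comm, ← Matrix.mul_assoc, hU, Matrix.one_mul, Matrix.trace_diagonal,
    Complex.re_sum]
  simp

lemma dpi (K : ι → Matrix m n ℂ) (hK : ∑ i, (K i)ᴴ * K i = 1) (ρ σ : Matrix n n ℂ)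
    (hρ : ρ.PosSemidef) (hσ : σ.PosSemidef)
    (U V : Matrix n n ℂ) (l u : n → ℝ) (hU : Uᴴ * U = 1) (hV : Vᴴ * V = 1)
    (hl : ∀ i, 0 ≤ l i) (hu : ∀ i, 0 ≤ u i)
    (hs : ∀ j i, u j = 0 → Complex.normSq ((Vᴴ * U) j i) * l i = 0)
    (U' V' : Matrix m m ℂ) (l' u' : m → ℝ) (hU' : U'ᴴ * U' = 1) (hV' : V'ᴴ * V' = 1)
    (hl' : ∀ i, 0 ≤ l' i) (hu' : ∀ i, 0 ≤ u' i)
    (hs' : ∀ j i, u' j = 0 → Complex.normSq ((V'ᴴ * U') j i) * l' i = 0)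
    (e1 : ρ = dg U l) (e2 : σ = dg V u)
    (e3 : ∑ i, K i * ρ * (K i)ᴴ = dg U' l') (e4 : ∑ i, K i * σ * (K i)ᴴ = dg V' u') :
    DD U' V' l' u' ≤ DD U V l u := by
  have hf : ∀ t, 0 < t → ff U' V' l' u' t ≤ ff U V l u t := by
    intro t ht
    obtain ⟨X, hX⟩ := GG_ex U' V' l' u' hU' hV' hl' hu' t ht
    rw [← hX, ← e3, ← e4]
    refine (GG_mono K hK ρ σ hρ hσ t ht X).trans ?_
    rw [e1, e2]
    exact GG_le U V l u hU hV hl hu t ht _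
  have htr : ∑ i, l' i = ∑ i, l i := by
    rw [← dg_tr U l hU, ← dg_tr U' l' hU', ← e1, ← e3, Matrix.trace_sum]
    congr 1
    calc ∑ i, (K i * ρ * (K i)ᴴ).trace = ∑ i, ((K i)ᴴ * K i * ρ).trace := by
          refine Finset.sum_congr rfl fun i _ => ?_
          rw [Matrix.trace_mul_comm, Matrix.mul_assoc]
      _ = ρ.trace := by rw [← Matrix.trace_sum, ← Matrix.sum_mul, hK, Matrix.one_mul]
  have hmono : MonotoneOn (fun t => Phi U V l u t - Phi U' V' l' u' t) (Set.Ici 0) := by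
    have hd : ∀ t : ℝ, 0 ≤ t → HasDerivAt (fun t => Phi U V l u t - Phi U' V' l' u' t)
        (ff U V l u t - ff U' V' l' u' t) t := fun t ht =>
      (Phi_deriv U V l u hl hu hs t ht).sub (Phi_deriv U' V' l' u' hl' hu' hs' t ht)
    refine monotoneOn_of_deriv_nonneg (convex_Ici 0)
      (fun t ht => (hd t ht).continuousAt.continuousWithinAt) ?_ ?_
    · intro t ht
      rw [interior_Ici] at ht
      exact (hd t (le_of_lt ht)).differentiableAt.differentiableWithinAt
    · intro t ht
      rw [interior_Ici] at ht
      rw [(hd t (le_of_lt ht)).deriv]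
      exact sub_nonneg.mpr (hf t ht)
  refine le_of_tendsto_of_tendsto (Phi_lim U' V' l' u' hU' hV' hl' hu')
    (Phi_lim U V l u hU hV hl hu) ?_
  filter_upwards [eventually_ge_atTop 0] with T hT
  have := hmono (Set.mem_Ici.mpr le_rfl) hT hT
  simp only [Phi_zero] at this
  rw [htr]
  linarith

lemma herm_dg (ρ : Matrix n n ℂ) (h : ρ.IsHermitian) :
    ρ = dg (h.eigenvectorUnitary : Matrix n n ℂ) h.eigenvalues := by
  conv_lhs => rw [h.spectral_theorem]
  simp [dg, Unitary.conjStarAlgAut_apply, Matrix.star_eq_conjTranspose, Function.comp_def]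

lemma herm_unit (ρ : Matrix n n ℂ) (h : ρ.IsHermitian) :
    (h.eigenvectorUnitary : Matrix n n ℂ)ᴴ * (h.eigenvectorUnitary : Matrix n n ℂ) = 1 :=
  Unitary.coe_star_mul_self h.eigenvectorUnitary

/-- relative-entropy-like quantity for matrices -/
noncomputable def DM (ρ σ : Matrix n n ℂ) (h : ρ.IsHermitian) (g : σ.IsHermitian) : ℝ :=
  DD (h.eigenvectorUnitary : Matrix n n ℂ) (g.eigenvectorUnitary : Matrix n n ℂ)
    h.eigenvalues g.eigenvalues

/-- diagonal expectation -/
lemma diag_exp (U V : Matrix n n ℂ) (l : n → ℝ) (j : n) :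
    ∑ i, Complex.normSq ((Vᴴ * U) j i) * l i = ((Vᴴ * dg U l * V) j j).re := by
  have : Vᴴ * dg U l * V = (Vᴴ * U) * diagonal (fun i => (l i : ℂ)) * (Vᴴ * U)ᴴ := by
    simp [dg, Matrix.mul_assoc]
  rw [this, Matrix.mul_apply, Complex.re_sum]
  refine Finset.sum_congr rfl fun i _ => ?_
  rw [Matrix.mul_diagonal, Matrix.conjTranspose_apply]
  simp [Complex.normSq_apply]
  ring

lemma dg_diag (V : Matrix n n ℂ) (hV : Vᴴ * V = 1) (u : n → ℝ) (j : n) :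
    ((Vᴴ * dg V u * V) j j).re = u j := by
  have : Vᴴ * dg V u * V = (Vᴴ * V) * diagonal (fun i => (u i : ℂ)) * (Vᴴ * V) := by
    simp [dg, Matrix.mul_assoc]
  rw [this, hV]; simp

variable {Ω : Type*} [Fintype Ω]

lemma avg_diag (p : Ω → ℝ) (ρ : Ω → Matrix n n ℂ) (hρ : ∀ x, (ρ x).PosSemidef)
    (g : (∑ x, p x • ρ x).IsHermitian) (j : n) :
    ∑ x, p x * ∑ i, Complex.normSq (((g.eigenvectorUnitary : Matrix n n ℂ)ᴴ *
      ((hρ x).1.eigenvectorUnitary : Matrix n n ℂ)) j i) * (hρ x).1.eigenvalues i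
      = g.eigenvalues j := by
  rw [← dg_diag _ (herm_unit _ g) g.eigenvalues j, ← herm_dg _ g]
  simp only [diag_exp, ← herm_dg]
  simp [Matrix.mul_sum, Matrix.sum_mul, Matrix.sum_apply]

lemma supp (p : Ω → ℝ) (hp0 : ∀ x, 0 ≤ p x) (ρ : Ω → Matrix n n ℂ)
    (hρ : ∀ x, (ρ x).PosSemidef)
    (g : (∑ x, p x • ρ x).IsHermitian) (x : Ω) (hx : p x ≠ 0) (j i : n)
    (hj : g.eigenvalues j = 0) :
    Complex.normSq (((g.eigenvectorUnitary : Matrix n n ℂ)ᴴ *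
      ((hρ x).1.eigenvectorUnitary : Matrix n n ℂ)) j i) * (hρ x).1.eigenvalues i = 0 := by
  have h := avg_diag p ρ hρ g j
  rw [hj] at h
  have hn : ∀ x, ∀ i, 0 ≤ Complex.normSq (((g.eigenvectorUnitary : Matrix n n ℂ)ᴴ *
      ((hρ x).1.eigenvectorUnitary : Matrix n n ℂ)) j i) * (hρ x).1.eigenvalues i :=
    fun x i => mul_nonneg (Complex.normSq_nonneg _) ((hρ x).eigenvalues_nonneg i)
  rw [Finset.sum_eq_zero_iff_of_nonneg
    (fun x _ => mul_nonneg (hp0 x) (Finset.sum_nonneg fun i _ => hn x i))] at h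
  have h2 := (mul_eq_zero.mp (h x (Finset.mem_univ _))).resolve_left hx
  rw [Finset.sum_eq_zero_iff_of_nonneg (fun i _ => hn x i)] at h2
  exact h2 i (Finset.mem_univ _)

lemma holevo_eq (p : Ω → ℝ) (ρ : Ω → Matrix n n ℂ) (hρ : ∀ x, (ρ x).PosSemidef)
    (g : (∑ x, p x • ρ x).IsHermitian) :
    vNE (∑ x, p x • ρ x) - ∑ x, p x * vNE (ρ x) = ∑ x, p x * DM (ρ x) _ (hρ x).1 g := by
  have h1 : ∀ x, vNE (ρ x) = -∑ i, (hρ x).1.eigenvalues i * Real.log ((hρ x).1.eigenvalues i) :=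
    fun x => by rw [vNE, dif_pos (hρ x).1]
  rw [vNE, dif_pos g]
  simp only [h1, DM, DD, mul_sub, Finset.sum_sub_distrib, mul_neg, Finset.sum_neg_distrib]
  have : ∑ j, g.eigenvalues j * Real.log (g.eigenvalues j) = ∑ x, p x * ∑ j, ∑ i,
      Complex.normSq (((g.eigenvectorUnitary : Matrix n n ℂ)ᴴ *
      ((hρ x).1.eigenvectorUnitary : Matrix n n ℂ)) j i) * (hρ x).1.eigenvalues i
       * Real.log (g.eigenvalues j) := by
    have hh : ∀ x, p x * ∑ j, ∑ i,
        Complex.normSq (((g.eigenvectorUnitary : Matrix n n ℂ)ᴴ *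
        ((hρ x).1.eigenvectorUnitary : Matrix n n ℂ)) j i) * (hρ x).1.eigenvalues i
         * Real.log (g.eigenvalues j) = ∑ j, (p x * ∑ i,
        Complex.normSq (((g.eigenvectorUnitary : Matrix n n ℂ)ᴴ *
        ((hρ x).1.eigenvectorUnitary : Matrix n n ℂ)) j i) * (hρ x).1.eigenvalues i)
         * Real.log (g.eigenvalues j) := by
      intro x
      rw [Finset.mul_sum]
      refine Finset.sum_congr rfl fun j _ => ?_
      rw [← Finset.sum_mul, mul_assoc]
    rw [Finset.sum_congr rfl (fun x _ => hh x), Finset.sum_comm]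
    refine Finset.sum_congr rfl fun j _ => ?_
    rw [← Finset.sum_mul, avg_diag p ρ hρ g j]
  rw [this]
  ring

lemma psd_sum (p : Ω → ℝ) (hp0 : ∀ x, 0 ≤ p x) (ρ : Ω → Matrix n n ℂ)
    (hρ : ∀ x, (ρ x).PosSemidef) : (∑ x, p x • ρ x).PosSemidef :=
  Matrix.posSemidef_sum _ fun x _ => (hρ x).smul (hp0 x)

end Helpers

/-- the Holevo quantity `χ = S(∑ₓ pₓ ρₓ) - ∑ₓ pₓ S(ρₓ)` of a finite ensemble of
density matrices is non-increasing under the action of a quantum channel `Λ` in Kraus form. -/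
theorem stmt3 {n m : ℕ} {Ω : Type*} [Fintype Ω] {ι : Type*} [Fintype ι]
    -- the ensemble {(p x, ρ x)}
    (p : Ω → ℝ) (hp0 : ∀ x, 0 ≤ p x) (hp1 : ∑ x, p x = 1)
    (ρ : Ω → Matrix (Fin n) (Fin n) ℂ)
    (hρ : ∀ x, (ρ x).PosSemidef) (hρtr : ∀ x, (ρ x).trace = 1)
    -- the channel Λ(σ) = ∑ i, K i σ (K i)ᴴ in Kraus form
    (K : ι → Matrix (Fin m) (Fin n) ℂ) (hK : ∑ i, (K i)ᴴ * K i = 1) :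
    vNE (∑ x, p x • (∑ i, K i * ρ x * (K i)ᴴ)) - ∑ x, p x * vNE (∑ i, K i * ρ x * (K i)ᴴ)
      ≤ vNE (∑ x, p x • ρ x) - ∑ x, p x * vNE (ρ x) := by
  have hL : ∀ x, (∑ i, K i * ρ x * (K i)ᴴ).PosSemidef := fun x =>
    Matrix.posSemidef_sum _ fun i _ => (hρ x).mul_mul_conjTranspose_same (K i)
  have gA := psd_sum p hp0 ρ hρ
  have gB := psd_sum p hp0 _ hL
  have eL : ∑ i, K i * (∑ x, p x • ρ x) * (K i)ᴴ = ∑ x, p x • (∑ i, K i * ρ x * (K i)ᴴ) := by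
    simp only [Matrix.mul_sum, Matrix.sum_mul, Finset.smul_sum, Matrix.mul_smul, Matrix.smul_mul]
    exact Finset.sum_comm
  rw [holevo_eq p ρ hρ gA.1, holevo_eq p _ hL gB.1]
  refine Finset.sum_le_sum fun x _ => ?_
  by_cases hx : p x = 0
  · simp [hx]
  refine mul_le_mul_of_nonneg_left ?_ (hp0 x)
  exact dpi K hK (ρ x) _ (hρ x) gA _ _ _ _ (herm_unit _ _) (herm_unit _ _)
    (hρ x).eigenvalues_nonneg gA.eigenvalues_nonneg
    (fun j i hj => supp p hp0 ρ hρ gA.1 x hx j i hj) _ _ _ _ (herm_unit _ _) (herm_unit _ _)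
    (hL x).eigenvalues_nonneg gB.eigenvalues_nonneg
    (fun j i hj => supp p hp0 _ hL gB.1 x hx j i hj)
    (herm_dg _ _) (herm_dg _ _) (herm_dg _ _) (eL.trans (herm_dg _ _))
end

section
/- Let ρ be a density matrix on ℂ^d. Let Alice's instrument be given by finite Kraus families: for each outcome x in a finite set Ω, Φ_x(ρ) = ∑_i K_{x,i} ρ K_{x,i}† with m×d matrices K_{x,i} satisfying ∑_{x,i} K_{x,i}† K_{x,i} = I_d; set p_x = Tr[Φ_x(ρ)] and, for p_x > 0, ρ_x = Φ_x(ρ)/p_x, and let Λ′_A(ρ) = ∑_x Φ_x(ρ). Let Λ′_B be any quantum channel in Kraus form from m×m to m′×m′ matrices. Then the information leakage I^H_c = [S(Λ′_A(ρ)) − ∑_{x: p_x>0} p_x S(ρ_x)] − [S(Λ′_B(Λ′_A(ρ))) − ∑_{x: p_x>0} p_x S(Λ′_B(ρ_x))] is nonnegative. -/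
open Matrix BigOperators Kronecker
open scoped ComplexOrder

lemma eigdec {n : Type*} [Fintype n] [DecidableEq n] {A : Matrix n n ℂ} (hA : A.IsHermitian) :
  ∃ U : Matrix n n ℂ, Uᴴ * U = 1 ∧ U * Uᴴ = 1 ∧ A = U * diagonal (fun i => (hA.eigenvalues i : ℂ)) * Uᴴ := by
  refine ⟨hA.eigenvectorUnitary, ?_, ?_, ?_⟩
  · exact Unitary.coe_star_mul_self hA.eigenvectorUnitary
  · exact Unitary.coe_mul_star_self hA.eigenvectorUnitary
  · have := hA.spectral_theorem
    rw [Unitary.conjStarAlgAut_apply] at this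
    exact this

section helpers

variable {n : Type*} [Fintype n] [DecidableEq n]

lemma vNE_eq {A U : Matrix n n ℂ} {f : n → ℝ} (h1 : Uᴴ * U = 1) 
    (hA : A = U * diagonal (fun i => (f i : ℂ)) * Uᴴ) : vNE A = - ∑ i, f i * Real.log (f i) := by
  have hh : A.IsHermitian := by
    rw [hA, Matrix.IsHermitian]
    simp [conjTranspose_mul, Matrix.mul_assoc, diagonal_conjTranspose]
    congr 3
    ext i; simp
  rw [vNE, dif_pos hh]
  have e1 := hh.roots_charpoly_eq_eigenvalues
  have e2 : A.charpoly = (diagonal (fun i => (f i : ℂ))).charpoly := by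
    rw [hA, Matrix.charpoly_mul_comm, ← Matrix.mul_assoc, h1, Matrix.one_mul]
  rw [e2, Matrix.charpoly_diagonal, Polynomial.roots_prod _ _ (Finset.prod_ne_zero_iff.2 fun i _ => Polynomial.X_sub_C_ne_zero _)] at e1
  simp only [Polynomial.roots_X_sub_C, Multiset.bind_singleton] at e1
  have e3 := congrArg (fun s : Multiset ℂ => (s.map (fun z => z.re * Real.log z.re)).sum) e1
  simp only [Multiset.map_map] at e3
  rw [neg_inj]
  exact e3.symm
  

theorem KS {n m κ : Type*} [Fintype n] [DecidableEq n] [Fintype m] [DecidableEq m] [Fintype κ]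
  (L : κ → Matrix m n ℂ) (hL : ∑ j, (L j)ᴴ * L j = 1) (B : Matrix n n ℂ) (hB : B.PosSemidef) (Z : Matrix m m ℂ) :
  (trace (B * (∑ k, (L k)ᴴ * Z * L k) * (∑ k, (L k)ᴴ * Z * L k)ᴴ)).re ≤ (trace ((∑ k, L k * B * (L k)ᴴ) * Z * Zᴴ)).re := by
  set W := ∑ k, (L k)ᴴ * Z * L k with hW
  have hWh : Wᴴ = ∑ k, (L k)ᴴ * Zᴴ * L k := by
    simp [hW, conjTranspose_sum, Matrix.mul_assoc]
  have key : ∑ k, (Zᴴ * L k - L k * Wᴴ)ᴴ * (Zᴴ * L k - L k * Wᴴ) = (∑ k, (L k)ᴴ * (Z * Zᴴ) * L k) - W * Wᴴ := by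
    have : ∀ k, (Zᴴ * L k - L k * Wᴴ)ᴴ * (Zᴴ * L k - L k * Wᴴ) = 
      (L k)ᴴ * (Z * Zᴴ) * L k - ((L k)ᴴ * Z * L k) * Wᴴ - W * ((L k)ᴴ * Zᴴ * L k) + W * ((L k)ᴴ * L k) * Wᴴ := by
      intro k
      simp only [conjTranspose_sub, conjTranspose_mul, conjTranspose_conjTranspose, Matrix.sub_mul, Matrix.mul_sub, Matrix.mul_assoc]
      abel
    simp only [this, Finset.sum_add_distrib, Finset.sum_sub_distrib, ← Finset.sum_mul, ← Finset.mul_sum, hL, ← hWh, ← hW]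
    noncomm_ring
  have e1 : trace ((∑ k, L k * B * (L k)ᴴ) * Z * Zᴴ) = trace (B * (∑ k, (L k)ᴴ * (Z * Zᴴ) * L k)) := by
    rw [Matrix.mul_assoc, Finset.sum_mul, Finset.mul_sum, trace_sum, trace_sum]
    refine Finset.sum_congr rfl fun k _ => ?_
    rw [Matrix.mul_assoc, Matrix.mul_assoc, trace_mul_comm]
    simp only [Matrix.mul_assoc]
  have e2 : trace (B * (∑ k, (L k)ᴴ * (Z * Zᴴ) * L k)) - trace (B * W * Wᴴ) = ∑ k, trace ((Zᴴ * L k - L k * Wᴴ) * B * (Zᴴ * L k - L k * Wᴴ)ᴴ) := by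
    rw [Matrix.mul_assoc, ← trace_sub, ← Matrix.mul_sub, ← key, Finset.mul_sum, trace_sum]
    refine Finset.sum_congr rfl fun k _ => ?_
    rw [← Matrix.mul_assoc, trace_mul_comm, Matrix.mul_assoc]
  have e3 : 0 ≤ ∑ k, trace ((Zᴴ * L k - L k * Wᴴ) * B * (Zᴴ * L k - L k * Wᴴ)ᴴ) := 
    Finset.sum_nonneg fun k _ => (hB.mul_mul_conjTranspose_same _).trace_nonneg
  rw [← e2] at e3
  have := (Complex.le_def.1 e3).1
  rw [e1]
  simp at this
  linarith

lemma re_tr1 (M Y : Matrix n n ℂ) (a : n → ℝ) : (trace (diagonal (fun i => (a i : ℂ)) * Mᴴ * Y)).re = 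
   ∑ j, ∑ i, a i * ((M j i).re * (Y j i).re + (M j i).im * (Y j i).im) := by
  rw [Finset.sum_comm]
  simp only [trace, diag_apply, Matrix.mul_assoc, Matrix.diagonal_mul]
  simp only [Matrix.mul_apply, Complex.re_sum, Finset.mul_sum]
  refine Finset.sum_congr rfl fun i _ => Finset.sum_congr rfl fun j _ => ?_
  simp 

lemma re_tr2 (Y : Matrix n n ℂ) (b : n → ℝ) : (trace (diagonal (fun i => (b i : ℂ)) * Y * Yᴴ)).re = 
   ∑ j, ∑ i, b j * Complex.normSq (Y j i) := by
  simp only [trace, diag_apply, Matrix.mul_assoc, Matrix.diagonal_mul]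
  simp only [Matrix.mul_apply, Complex.re_sum, Finset.mul_sum]
  refine Finset.sum_congr rfl fun i _ => Finset.sum_congr rfl fun j _ => ?_
  simp [Complex.normSq_apply]

noncomputable def JJ (A B Z : Matrix n n ℂ) (t : ℝ) : ℝ := 
  2 * (trace (A * Z)).re - (trace (B * Z * Zᴴ)).re - t * (trace (A * Zᴴ * Z)).re

lemma JJ_coord (A B U V Y : Matrix n n ℂ) (t : ℝ) (a b : n → ℝ) (hU : Uᴴ * U = 1) (hV : Vᴴ * V = 1)
   (hA : A = U * diagonal (fun i => (a i : ℂ)) * Uᴴ) (hB : B = V * diagonal (fun i => (b i : ℂ)) * Vᴴ) :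
   JJ A B (V * Y * Uᴴ) t = ∑ j, ∑ i, (2 * a i * (((Vᴴ * U) j i).re * (Y j i).re + ((Vᴴ * U) j i).im * (Y j i).im)
      - (b j + t * a i) * Complex.normSq (Y j i)) := by
  have hU' : ∀ X : Matrix n n ℂ, Uᴴ * (U * X) = X := fun X => by rw [← Matrix.mul_assoc, hU, Matrix.one_mul]
  have hV' : ∀ X : Matrix n n ℂ, Vᴴ * (V * X) = X := fun X => by rw [← Matrix.mul_assoc, hV, Matrix.one_mul]
  have e1 : trace (A * (V * Y * Uᴴ)) = trace (diagonal (fun i => (a i : ℂ)) * (Vᴴ * U)ᴴ * Y) := by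
    rw [hA, Matrix.mul_assoc, Matrix.mul_assoc, trace_mul_comm]
    simp only [conjTranspose_mul, conjTranspose_conjTranspose, Matrix.mul_assoc, hU, Matrix.mul_one]
  have e2 : trace (B * (V * Y * Uᴴ) * (V * Y * Uᴴ)ᴴ) = trace (diagonal (fun i => (b i : ℂ)) * Y * Yᴴ) := by
    rw [hB]
    simp only [conjTranspose_mul, conjTranspose_conjTranspose, Matrix.mul_assoc]
    rw [trace_mul_comm]
    simp only [hU', hV', hV, Matrix.mul_assoc, Matrix.mul_one]
  have e3 : trace (A * (V * Y * Uᴴ)ᴴ * (V * Y * Uᴴ)) = trace (diagonal (fun i => (a i : ℂ)) * Yᴴ * Y) := by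
    rw [hA]
    simp only [conjTranspose_mul, conjTranspose_conjTranspose, Matrix.mul_assoc]
    rw [trace_mul_comm]
    simp only [hU', hV', hU, Matrix.mul_assoc, Matrix.mul_one]
  rw [JJ, e1, e2, e3, re_tr1, re_tr1, re_tr2]
  simp only [Finset.mul_sum, ← Finset.sum_sub_distrib]
  refine Finset.sum_congr rfl fun i _ => Finset.sum_congr rfl fun j _ => ?_
  simp only [Complex.normSq_apply]
  ring

noncomputable def gg (M : Matrix n n ℂ) (a b : n → ℝ) (t : ℝ) : ℝ := ∑ j, ∑ i, Complex.normSq (M j i) * a i * (a i / (b j + t * a i))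

lemma JJ_le (A B U V Z : Matrix n n ℂ) (t : ℝ) (ht : 0 < t) (a b : n → ℝ) (ha : ∀ i, 0 ≤ a i) (hb : ∀ i, 0 ≤ b i) (hU : Uᴴ * U = 1) (hV : Vᴴ * V = 1)
   (hU2 : U * Uᴴ = 1) (hV2 : V * Vᴴ = 1)
   (hA : A = U * diagonal (fun i => (a i : ℂ)) * Uᴴ) (hB : B = V * diagonal (fun i => (b i : ℂ)) * Vᴴ) :
   JJ A B Z t ≤ gg (Vᴴ * U) a b t := by
  have : Z = V * (Vᴴ * Z * U) * Uᴴ := by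
    simp only [Matrix.mul_assoc, hU2, Matrix.mul_one]
    rw [← Matrix.mul_assoc, hV2, Matrix.one_mul]
  rw [this, JJ_coord A B U V _ t a b hU hV hA hB, gg]
  refine Finset.sum_le_sum fun j _ => Finset.sum_le_sum fun i _ => ?_
  generalize (Vᴴ * U) j i = x
  generalize (Vᴴ * Z * U) j i = y
  simp only [Complex.normSq_apply]
  rcases (ha i).eq_or_lt with h | h
  · rw [← h]
    have := mul_nonneg (hb j) (add_nonneg (mul_self_nonneg y.re) (mul_self_nonneg y.im))
    simp; linarith
  · have hc : 0 < b j + t * a i := by have := hb j; positivity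
    generalize b j + t * a i = c at *
    rw [← mul_div_assoc, le_div_iff₀ hc]
    nlinarith [sq_nonneg (a i * x.re - c * y.re), sq_nonneg (a i * x.im - c * y.im)]

lemma JJ_eq (A B U V : Matrix n n ℂ) (t : ℝ) (ht : 0 < t) (a b : n → ℝ) (ha : ∀ i, 0 ≤ a i) (hb : ∀ i, 0 ≤ b i) (hU : Uᴴ * U = 1) (hV : Vᴴ * V = 1)
   (hA : A = U * diagonal (fun i => (a i : ℂ)) * Uᴴ) (hB : B = V * diagonal (fun i => (b i : ℂ)) * Vᴴ) :
   ∃ Z, JJ A B Z t = gg (Vᴴ * U) a b t := by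
  refine ⟨V * (Matrix.of fun j i => (((a i / (b j + t * a i) : ℝ)) : ℂ) * (Vᴴ * U) j i) * Uᴴ, ?_⟩
  rw [JJ_coord A B U V _ t a b hU hV hA hB, gg]
  refine Finset.sum_congr rfl fun j _ => Finset.sum_congr rfl fun i _ => ?_
  rw [Matrix.of_apply]
  generalize (Vᴴ * U) j i = x
  rcases (ha i).eq_or_lt with h | h
  · rw [← h]; simp
  · have hc : 0 < b j + t * a i := by have := hb j; positivity
    simp only [Complex.normSq_apply, Complex.re_ofReal_mul, Complex.im_ofReal_mul]
    generalize b j + t * a i = c at *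
    field_simp
    ring

theorem JJ_mono {n m κ : Type*} [Fintype n] [DecidableEq n] [Fintype m] [DecidableEq m] [Fintype κ]
  (L : κ → Matrix m n ℂ) (hL : ∑ j, (L j)ᴴ * L j = 1) (A B : Matrix n n ℂ) (hA : A.PosSemidef) (hB : B.PosSemidef) (Z : Matrix m m ℂ)
  (t : ℝ) (ht : 0 < t) :
  JJ (∑ k, L k * A * (L k)ᴴ) (∑ k, L k * B * (L k)ᴴ) Z t ≤ JJ A B (∑ k, (L k)ᴴ * Z * L k) t := by
  have h1 := KS L hL B hB Z
  have h2 := KS L hL A hA Zᴴ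
  have hWh : (∑ k, (L k)ᴴ * Z * L k)ᴴ = ∑ k, (L k)ᴴ * Zᴴ * L k := by
    simp [conjTranspose_sum, Matrix.mul_assoc]
  rw [← hWh, conjTranspose_conjTranspose, conjTranspose_conjTranspose] at h2
  have h3 : trace ((∑ k, L k * A * (L k)ᴴ) * Z) = trace (A * ∑ k, (L k)ᴴ * Z * L k) := by
    rw [Finset.sum_mul, Finset.mul_sum, trace_sum, trace_sum]
    refine Finset.sum_congr rfl fun k _ => ?_
    rw [Matrix.mul_assoc, Matrix.mul_assoc, trace_mul_comm]
    simp only [Matrix.mul_assoc]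
  unfold JJ
  rw [h3]
  have := mul_le_mul_of_nonneg_left h2 ht.le
  linarith

/-- Q -/
noncomputable def QQ (M : Matrix n n ℂ) (a b : n → ℝ) (t : ℝ) : ℝ :=
  ∑ j, ∑ i, Complex.normSq (M j i) * a i * (Real.log (b j + t * a i) - Real.log (a i))

lemma QQ_deriv (M : Matrix n n ℂ) (a b : n → ℝ) (ha : ∀ i, 0 ≤ a i) (hb : ∀ i, 0 ≤ b i) (t : ℝ) (ht : 0 < t) :
    HasDerivAt (QQ M a b) (gg M a b t) t := by
  unfold QQ gg
  refine HasDerivAt.fun_sum fun j _ => HasDerivAt.fun_sum fun i _ => ?_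
  rcases (ha i).eq_or_lt with h | h
  · simp only [← h, mul_zero, zero_mul]
    exact hasDerivAt_const _ _
  · have hc : 0 < b j + t * a i := by have := hb j; positivity
    refine HasDerivAt.const_mul _ (HasDerivAt.sub_const _ (HasDerivAt.log ?_ hc.ne'))
    simpa using ((hasDerivAt_id t).mul_const (a i)).const_add (b j)

lemma QQ_cont (M : Matrix n n ℂ) (a b : n → ℝ) (ha : ∀ i, 0 ≤ a i) (hb : ∀ i, 0 ≤ b i) 
   (hab : ∀ j i, b j = 0 → Complex.normSq (M j i) * a i = 0) : ContinuousOn (QQ M a b) (Set.Ici 0) := by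
  unfold QQ
  refine continuousOn_finsetSum _ fun j _ => continuousOn_finsetSum _ fun i _ => ?_
  rcases (hb j).eq_or_lt with h | h
  · simp only [hab j i h.symm, zero_mul]
    exact continuousOn_const
  · refine continuousOn_const.mul (ContinuousOn.sub (ContinuousOn.log (by fun_prop) ?_) continuousOn_const)
    intro t ht
    have := mul_nonneg (Set.mem_Ici.1 ht) (ha i)
    linarith

open Filter Topology in
lemma QQ_lim (M : Matrix n n ℂ) (a b : n → ℝ) (ha : ∀ i, 0 ≤ a i) (hb : ∀ i, 0 ≤ b i) :
    Tendsto (fun t => QQ M a b t - (∑ j, ∑ i, Complex.normSq (M j i) * a i) * Real.log t) atTop (𝓝 0) := by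
  have : (0:ℝ) = ∑ j : n, ∑ i : n, 0 := by simp
  rw [this]
  simp only [QQ, Finset.sum_mul, ← Finset.sum_sub_distrib]
  refine tendsto_finsetSum _ fun j _ => tendsto_finsetSum _ fun i _ => ?_
  rcases (ha i).eq_or_lt with h | h
  · simp [← h]
  · have h1 : Tendsto (fun t : ℝ => b j / t + a i) atTop (𝓝 (0 + a i)) :=
      (tendsto_const_nhds.div_atTop tendsto_id).add_const _
    rw [zero_add] at h1
    have h2 := (((Real.continuousAt_log h.ne').tendsto.comp h1).sub_const (Real.log (a i))).const_mul (Complex.normSq (M j i) * a i)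
    rw [sub_self, mul_zero] at h2
    refine h2.congr' ?_
    filter_upwards [eventually_gt_atTop 0] with t ht
    have hc : 0 < b j + t * a i := by have := hb j; positivity
    have : b j / t + a i = (b j + t * a i) / t := by field_simp
    simp only [Function.comp, this]
    rw [Real.log_div hc.ne' ht.ne']
    ring

lemma diag_coord (A U V : Matrix n n ℂ) (a : n → ℝ)
   (hA : A = U * diagonal (fun i => (a i : ℂ)) * Uᴴ) (j : n) :
   ((Vᴴ * A * V) j j).re = ∑ i, Complex.normSq ((Vᴴ * U) j i) * a i := by
  have : Vᴴ * A * V = (Vᴴ * U) * diagonal (fun i => (a i : ℂ)) * (Vᴴ * U)ᴴ := by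
    simp [hA, Matrix.mul_assoc]
  rw [this]
  generalize Vᴴ * U = M
  rw [Matrix.mul_apply, Complex.re_sum]
  refine Finset.sum_congr rfl fun i _ => ?_
  simp [Complex.normSq_apply, Matrix.mul_diagonal]
  ring

lemma diag_self (B V : Matrix n n ℂ) (b : n → ℝ) (hV : Vᴴ * V = 1)
   (hB : B = V * diagonal (fun i => (b i : ℂ)) * Vᴴ) (j : n) :
   ((Vᴴ * B * V) j j).re = b j := by
  have : Vᴴ * B * V = (Vᴴ * V) * diagonal (fun i => (b i : ℂ)) * (Vᴴ * V) := by
    simp [hB, Matrix.mul_assoc]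
  rw [this, hV]
  simp

lemma supp_s4 (A B U V : Matrix n n ℂ) (a b : n → ℝ) (ha : ∀ i, 0 ≤ a i) (hV : Vᴴ * V = 1)
   (hA : A = U * diagonal (fun i => (a i : ℂ)) * Uᴴ) (hB : B = V * diagonal (fun i => (b i : ℂ)) * Vᴴ)
   (hAB : (B - A).PosSemidef) :
   ∀ j i, b j = 0 → Complex.normSq ((Vᴴ * U) j i) * a i = 0 := by
  intro j i hj
  have h1 := (Complex.le_def.1 ((hAB.conjTranspose_mul_mul_same V).diag_nonneg (i := j))).1
  rw [Matrix.mul_sub, Matrix.sub_mul, Matrix.sub_apply, Complex.sub_re, diag_coord A U V a hA, diag_self B V b hV hB, hj] at h1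
  have h2 : ∀ i ∈ Finset.univ, 0 ≤ Complex.normSq ((Vᴴ * U) j i) * a i := fun i _ => mul_nonneg (Complex.normSq_nonneg _) (ha i)
  have h3 := Finset.sum_nonneg h2
  have h4 : ∑ i, Complex.normSq ((Vᴴ * U) j i) * a i = 0 := by
    simp at h1; linarith
  exact (Finset.sum_eq_zero_iff_of_nonneg h2).1 h4 i (Finset.mem_univ _)

lemma sum_tr (A U V : Matrix n n ℂ) (a : n → ℝ) (hV2 : V * Vᴴ = 1)
   (hA : A = U * diagonal (fun i => (a i : ℂ)) * Uᴴ) :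
   ∑ j, ∑ i, Complex.normSq ((Vᴴ * U) j i) * a i = (trace A).re := by
  simp only [← diag_coord A U V a hA]
  rw [← Complex.re_sum]
  change (trace (Vᴴ * A * V)).re = _
  rw [trace_mul_comm, ← Matrix.mul_assoc, hV2, Matrix.one_mul]

/-- value at zero -/
lemma QQ_zero (A B U V : Matrix n n ℂ) (a b : n → ℝ) (hU : Uᴴ * U = 1) (hV2 : V * Vᴴ = 1)
   (hA : A = U * diagonal (fun i => (a i : ℂ)) * Uᴴ) :
   QQ (Vᴴ * U) a b 0 = ∑ j, ((Vᴴ * A * V) j j).re * Real.log (b j) + vNE A := by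
  rw [vNE_eq hU hA]
  have h : ∀ i, ∑ j, Complex.normSq ((Vᴴ * U) j i) = 1 := by
    intro i
    have : (Vᴴ * U)ᴴ * (Vᴴ * U) = 1 := by
      rw [conjTranspose_mul, conjTranspose_conjTranspose, Matrix.mul_assoc, ← Matrix.mul_assoc V, hV2, Matrix.one_mul, hU]
    have h2 := congrArg Complex.re (congrFun (congrFun this i) i)
    rw [Matrix.mul_apply, Complex.re_sum] at h2
    simp at h2
    rw [← h2]
    refine Finset.sum_congr rfl fun j _ => ?_
    simp [Complex.normSq_apply]
  simp only [diag_coord A U V a hA, QQ, mul_sub, Finset.sum_sub_distrib, zero_mul, add_zero, ← sub_eq_add_neg, Finset.sum_mul]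
  congr 1
  rw [Finset.sum_comm]
  refine Finset.sum_congr rfl fun i _ => ?_
  simp only [mul_assoc, ← Finset.sum_mul, h, one_mul]

lemma chan_tr {n m κ : Type*} [Fintype n] [DecidableEq n] [Fintype m] [DecidableEq m] [Fintype κ]
  (L : κ → Matrix m n ℂ) (hL : ∑ j, (L j)ᴴ * L j = 1) (A : Matrix n n ℂ) : trace (∑ k, L k * A * (L k)ᴴ) = trace A := by
  rw [trace_sum]
  simp only [fun k => trace_mul_comm (L k * A) (L k)ᴴ, ← Matrix.mul_assoc, ← trace_sum, ← Finset.sum_mul, hL, Matrix.one_mul]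

lemma chan_psd {n m κ : Type*} [Fintype n] [DecidableEq n] [Fintype m] [DecidableEq m] [Fintype κ]
  (L : κ → Matrix m n ℂ) (A : Matrix n n ℂ) (hA : A.PosSemidef) : (∑ k, L k * A * (L k)ᴴ).PosSemidef :=
  Matrix.posSemidef_sum _ fun k _ => hA.mul_mul_conjTranspose_same _

open Filter Topology in
theorem QQ_mono {n m κ : Type*} [Fintype n] [DecidableEq n] [Fintype m] [DecidableEq m] [Fintype κ]
  (L : κ → Matrix m n ℂ) (hL : ∑ j, (L j)ᴴ * L j = 1) (A B U V : Matrix n n ℂ) (a b : n → ℝ) (ha : ∀ i, 0 ≤ a i) (hb : ∀ i, 0 ≤ b i)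
   (hU : Uᴴ * U = 1) (hV : Vᴴ * V = 1) (hU2 : U * Uᴴ = 1) (hV2 : V * Vᴴ = 1)
   (hA : A = U * diagonal (fun i => (a i : ℂ)) * Uᴴ) (hB : B = V * diagonal (fun i => (b i : ℂ)) * Vᴴ)
   (hAB : (B - A).PosSemidef) (pA : A.PosSemidef) (pB : B.PosSemidef)
   (U' V' : Matrix m m ℂ) (a' b' : m → ℝ) (ha' : ∀ i, 0 ≤ a' i) (hb' : ∀ i, 0 ≤ b' i)
   (hU' : U'ᴴ * U' = 1) (hV' : V'ᴴ * V' = 1) (hV2' : V' * V'ᴴ = 1)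
   (hA' : ∑ k, L k * A * (L k)ᴴ = U' * diagonal (fun i => (a' i : ℂ)) * U'ᴴ) (hB' : ∑ k, L k * B * (L k)ᴴ = V' * diagonal (fun i => (b' i : ℂ)) * V'ᴴ) :
   QQ (Vᴴ * U) a b 0 ≤ QQ (V'ᴴ * U') a' b' 0 := by
  have hg : ∀ t, 0 < t → gg (V'ᴴ * U') a' b' t ≤ gg (Vᴴ * U) a b t := by
    intro t ht
    obtain ⟨Z, hZ⟩ := JJ_eq _ _ U' V' t ht a' b' ha' hb' hU' hV' hA' hB'
    rw [← hZ]
    exact (JJ_mono L hL A B pA pB Z t ht).trans (JJ_le A B U V _ t ht a b ha hb hU hV hU2 hV2 hA hB)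
  have hAB' : (∑ k, L k * B * (L k)ᴴ - ∑ k, L k * A * (L k)ᴴ).PosSemidef := by
    have := chan_psd L _ hAB
    simpa only [Matrix.mul_sub, Matrix.sub_mul, Finset.sum_sub_distrib] using this
  have c1 := QQ_cont (Vᴴ * U) a b ha hb (supp_s4 A B U V a b ha hV hA hB hAB)
  have c2 := QQ_cont (V'ᴴ * U') a' b' ha' hb' (supp_s4 _ _ U' V' a' b' ha' hV' hA' hB' hAB')
  have hd : ∀ t, 0 < t → HasDerivAt (fun t => QQ (V'ᴴ * U') a' b' t - QQ (Vᴴ * U) a b t) (gg (V'ᴴ * U') a' b' t - gg (Vᴴ * U) a b t) t :=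
    fun t ht => (QQ_deriv _ a' b' ha' hb' t ht).sub (QQ_deriv _ a b ha hb t ht)
  have hanti : AntitoneOn (fun t => QQ (V'ᴴ * U') a' b' t - QQ (Vᴴ * U) a b t) (Set.Ici 0) := by
    refine antitoneOn_of_deriv_nonpos (convex_Ici 0) (c2.sub c1) ?_ ?_
    · rw [interior_Ici]
      exact fun t ht => (hd t ht).differentiableAt.differentiableWithinAt
    · rw [interior_Ici]
      intro t ht
      rw [(hd t ht).deriv]
      linarith [hg t ht]
  have l1 := QQ_lim (Vᴴ * U) a b ha hb
  have l2 := QQ_lim (V'ᴴ * U') a' b' ha' hb'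
  rw [sum_tr A U V a hV2 hA] at l1
  rw [sum_tr _ U' V' a' hV2' hA', chan_tr L hL] at l2
  have l3 := l2.sub l1
  rw [sub_zero] at l3
  have h0 : (0:ℝ) ≤ QQ (V'ᴴ * U') a' b' 0 - QQ (Vᴴ * U) a b 0 := by
    refine le_of_tendsto l3 ?_
    filter_upwards [eventually_ge_atTop 0] with t ht
    have := hanti (Set.mem_Ici.2 le_rfl) (Set.mem_Ici.2 ht) ht
    simp only at this
    linarith
  linarith

theorem holevo {n m κ Ω : Type*} [Fintype n] [DecidableEq n] [Fintype m] [DecidableEq m] [Fintype κ] [Fintype Ω]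
  (L : κ → Matrix m n ℂ) (hL : ∑ j, (L j)ᴴ * L j = 1) (A : Ω → Matrix n n ℂ) (hA : ∀ x, (A x).PosSemidef) :
  ∑ x, vNE (A x) - vNE (∑ x, A x) ≤ ∑ x, vNE (∑ k, L k * A x * (L k)ᴴ) - vNE (∑ k, L k * (∑ x, A x) * (L k)ᴴ) := by
  classical
  have pB : (∑ x, A x).PosSemidef := Matrix.posSemidef_sum _ fun x _ => hA x
  have pB' := chan_psd L _ pB
  have pA' := fun x => chan_psd L _ (hA x)
  obtain ⟨V, hV, hV2, hB⟩ := eigdec pB.1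
  obtain ⟨V', hV', hV2', hB'⟩ := eigdec pB'.1
  choose U hU hU2 hUA using fun x => eigdec (hA x).1
  choose U' hU' hU2' hUA' using fun x => eigdec (pA' x).1
  have hle : ∀ x, (∑ y, A y - A x).PosSemidef := by
    intro x
    rw [← Finset.add_sum_erase _ _ (Finset.mem_univ x), add_sub_cancel_left]
    exact Matrix.posSemidef_sum _ fun x _ => hA x
  have key := Finset.sum_le_sum fun x (_ : x ∈ Finset.univ) => QQ_mono L hL (A x) (∑ x, A x) (U x) V _ _ (hA x).eigenvalues_nonneg pB.eigenvalues_nonneg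
    (hU x) hV (hU2 x) hV2 (hUA x) hB (hle x) (hA x) pB (U' x) V' _ _ (pA' x).eigenvalues_nonneg pB'.eigenvalues_nonneg
    (hU' x) hV' hV2' (hUA' x) hB'
  have s1 : ∑ x, QQ (Vᴴ * U x) (hA x).1.eigenvalues pB.1.eigenvalues 0 = ∑ x, vNE (A x) - vNE (∑ x, A x) := by
    simp only [fun x => QQ_zero (A x) (∑ x, A x) (U x) V _ pB.1.eigenvalues (hU x) hV2 (hUA x), Finset.sum_add_distrib]
    rw [vNE_eq hV hB, Finset.sum_comm, sub_neg_eq_add, add_comm]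
    congr 1
    refine Finset.sum_congr rfl fun j _ => ?_
    rw [← Finset.sum_mul]
    congr 1
    refine Eq.trans ?_ (diag_self _ V _ hV hB j)
    simp only [Finset.mul_sum, Finset.sum_mul, Matrix.sum_apply, Complex.re_sum]
  have s2 : ∑ x, QQ (V'ᴴ * U' x) (pA' x).1.eigenvalues pB'.1.eigenvalues 0 = ∑ x, vNE (∑ k, L k * A x * (L k)ᴴ) - vNE (∑ k, L k * (∑ x, A x) * (L k)ᴴ) := by
    simp only [fun x => QQ_zero _ (∑ k, L k * (∑ x, A x) * (L k)ᴴ) (U' x) V' _ pB'.1.eigenvalues (hU' x) hV2' (hUA' x), Finset.sum_add_distrib]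
    rw [vNE_eq hV' hB', Finset.sum_comm, sub_neg_eq_add, add_comm]
    congr 1
    refine Finset.sum_congr rfl fun j _ => ?_
    rw [← Finset.sum_mul]
    congr 1
    refine Eq.trans ?_ (diag_self _ V' _ hV' hB' j)
    have : ∑ k, L k * (∑ x, A x) * (L k)ᴴ = ∑ x, ∑ k, L k * A x * (L k)ᴴ := by
      rw [Finset.sum_comm]
      simp only [Matrix.mul_sum, Matrix.sum_mul]
    rw [this, Matrix.mul_sum, Matrix.sum_mul, Matrix.sum_apply, Complex.re_sum]
  rw [← s1, ← s2]
  exact key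

lemma vNE_zero : vNE (0 : Matrix n n ℂ) = 0 := by
  have := vNE_eq (A := (0 : Matrix n n ℂ)) (U := 1) (f := 0) (by simp) (by simp)
  simpa using this

lemma vNE_smul (A : Matrix n n ℂ) (hA : A.PosSemidef) (p : ℝ) (hp : 0 < p) (htr : (trace A).re = p) :
   p * vNE (p⁻¹ • A) = vNE A + p * Real.log p := by
  obtain ⟨U, hU, hU2, hUA⟩ := eigdec hA.1
  have e : p⁻¹ • A = U * diagonal (fun i => ((p⁻¹ * hA.1.eigenvalues i : ℝ) : ℂ)) * Uᴴ := by
    have : diagonal (fun i => ((p⁻¹ * hA.1.eigenvalues i : ℝ) : ℂ)) = p⁻¹ • diagonal (fun i => ((hA.1.eigenvalues i : ℝ) : ℂ)) := by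
      rw [← diagonal_smul]
      congr 1
      ext i
      simp
    rw [this, Matrix.mul_smul, Matrix.smul_mul, ← hUA]
  rw [vNE_eq hU e, vNE_eq hU hUA]
  have ht : ∑ i, hA.1.eigenvalues i = p := by
    rw [← htr, hA.1.trace_eq_sum_eigenvalues]; simp
  nth_rw 4 [← ht]
  rw [Finset.sum_mul, mul_neg, Finset.mul_sum, neg_add_eq_sub, ← Finset.sum_sub_distrib, ← Finset.sum_neg_distrib]
  refine Finset.sum_congr rfl fun i _ => ?_
  rcases (hA.eigenvalues_nonneg i).eq_or_lt with h | h
  · rw [← h]; simp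
  · rw [Real.log_mul (by positivity) h.ne', Real.log_inv]
    field_simp
    ring

end helpers

/-- with Alice's instrument `{Φₓ}` (each `Φₓ` in Kraus form, summing to a
channel `Λ'_A`), `pₓ = Tr[Φₓ(ρ)]`, `ρₓ = Φₓ(ρ)/pₓ` for `pₓ > 0`, and Eve's channel `Λ'_B`,
the information leakage
`I^H_c = [S(Λ'_A(ρ)) - ∑_{pₓ>0} pₓ S(ρₓ)] - [S(Λ'_B(Λ'_A(ρ))) - ∑_{pₓ>0} pₓ S(Λ'_B(ρₓ))]`
is nonnegative. -/
theorem stmt4 {d m m' : ℕ} {Ω : Type*} [Fintype Ω] [DecidableEq Ω]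
    {ι : Ω → Type*} [∀ x, Fintype (ι x)] {κ : Type*} [Fintype κ]
    -- ρ is a density matrix on ℂ^d
    (ρ : Matrix (Fin d) (Fin d) ℂ) (hρ : ρ.PosSemidef) (hρtr : ρ.trace = 1)
    -- Alice's instrument: Φ x (σ) = ∑ i, K x i * σ * (K x i)ᴴ, trace preserving in total
    (K : (x : Ω) → ι x → Matrix (Fin m) (Fin d) ℂ)
    (hK : ∑ x, ∑ i, (K x i)ᴴ * K x i = 1)
    -- Eve's channel Λ'_B in Kraus form
    (L : κ → Matrix (Fin m') (Fin m) ℂ) (hL : ∑ j, (L j)ᴴ * L j = 1) :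
    0 ≤ (vNE (∑ x, ∑ i, K x i * ρ * (K x i)ᴴ)
          - ∑ x ∈ Finset.univ.filter
              (fun x => 0 < ((∑ i, K x i * ρ * (K x i)ᴴ).trace).re),
              ((∑ i, K x i * ρ * (K x i)ᴴ).trace).re *
                vNE ((((∑ i, K x i * ρ * (K x i)ᴴ).trace).re)⁻¹ •
                  (∑ i, K x i * ρ * (K x i)ᴴ)))
        - (vNE (∑ j, L j * (∑ x, ∑ i, K x i * ρ * (K x i)ᴴ) * (L j)ᴴ)
          - ∑ x ∈ Finset.univ.filter
              (fun x => 0 < ((∑ i, K x i * ρ * (K x i)ᴴ).trace).re),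
              ((∑ i, K x i * ρ * (K x i)ᴴ).trace).re *
                vNE (∑ j, L j * ((((∑ i, K x i * ρ * (K x i)ᴴ).trace).re)⁻¹ •
                  (∑ i, K x i * ρ * (K x i)ᴴ)) * (L j)ᴴ)) := by
  have hA : ∀ x, (∑ i, K x i * ρ * (K x i)ᴴ).PosSemidef := fun x => chan_psd (K x) ρ hρ
  have h := holevo L hL (fun x => ∑ i, K x i * ρ * (K x i)ᴴ) hA
  generalize hAx : (fun x => ∑ i, K x i * ρ * (K x i)ᴴ) = A at *
  have hAx' : ∀ x, ∑ i, K x i * ρ * (K x i)ᴴ = A x := fun x => congrFun hAx x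
  simp only [hAx'] at h hA ⊢
  have hz : ∀ x, ¬ 0 < (A x).trace.re → A x = 0 := by
    intro x hx
    have h1 := Complex.le_def.1 (hA x).trace_nonneg
    refine (hA x).trace_eq_zero_iff.1 (Complex.ext ?_ ?_)
    · have := h1.1
      simp at this ⊢
      linarith
    · exact h1.2.symm
  have f1 : ∑ x, vNE (A x) = ∑ x ∈ Finset.univ.filter (fun x => 0 < (A x).trace.re), vNE (A x) := by
    rw [Finset.sum_filter]
    refine Finset.sum_congr rfl fun x _ => ?_
    split_ifs with hx
    · rfl
    · rw [hz x hx, vNE_zero]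
  have f2 : ∑ x, vNE (∑ k, L k * A x * (L k)ᴴ) = ∑ x ∈ Finset.univ.filter (fun x => 0 < (A x).trace.re), vNE (∑ k, L k * A x * (L k)ᴴ) := by
    rw [Finset.sum_filter]
    refine Finset.sum_congr rfl fun x _ => ?_
    split_ifs with hx
    · rfl
    · simp [hz x hx, vNE_zero]
  have g1 : ∑ x ∈ Finset.univ.filter (fun x => 0 < (A x).trace.re), (A x).trace.re * vNE ((A x).trace.re⁻¹ • A x)
      = ∑ x ∈ Finset.univ.filter (fun x => 0 < (A x).trace.re), (vNE (A x) + (A x).trace.re * Real.log (A x).trace.re) :=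
    Finset.sum_congr rfl fun x hx => vNE_smul (A x) (hA x) _ (Finset.mem_filter.1 hx).2 rfl
  have g2 : ∑ x ∈ Finset.univ.filter (fun x => 0 < (A x).trace.re), (A x).trace.re * vNE (∑ k, L k * ((A x).trace.re⁻¹ • A x) * (L k)ᴴ)
      = ∑ x ∈ Finset.univ.filter (fun x => 0 < (A x).trace.re), (vNE (∑ k, L k * A x * (L k)ᴴ) + (A x).trace.re * Real.log (A x).trace.re) := by
    refine Finset.sum_congr rfl fun x hx => ?_
    rw [← vNE_smul _ (chan_psd L _ (hA x)) _ (Finset.mem_filter.1 hx).2 (by rw [chan_tr L hL])]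
    simp only [Matrix.mul_smul, Matrix.smul_mul, Finset.smul_sum]
  rw [g1, g2, Finset.sum_add_distrib, Finset.sum_add_distrib, ← f1, ← f2]
  linarith
end

section
/- Let X = {X_x}_{x=1}^d and Y = {Y_j}_{j=1}^d be rank-one PVMs on ℂ^d with X_x Y_j = Y_j X_x for all x, j. Then for every density matrix ρ on ℂ^d the modified context-incompatibility measure vanishes: 𝔦(ρ, X, Y) := [S(N_X(ρ)) − ∑_{x: p_x>0} p_x S(ρ_x)] − [S(N_Y(N_X(ρ))) − ∑_{x: p_x>0} p_x S(N_Y(ρ_x))] = 0, where p_x = Tr(X_x ρ) and ρ_x = X_x ρ X_x / p_x for p_x > 0. -/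
open Matrix BigOperators Kronecker
open scoped ComplexOrder

/-- The modified context-incompatibility measure
`𝔦(ρ,X,Y) = [S(N_X ρ) - ∑_{pₓ>0} pₓ S(ρₓ)] - [S(N_Y(N_X ρ)) - ∑_{pₓ>0} pₓ S(N_Y ρₓ)]`,
where `pₓ = Tr(Xₓ ρ)` and `ρₓ = Xₓ ρ Xₓ / pₓ`. -/
noncomputable def modIPC {d : ℕ} (ρ : Matrix (Fin d) (Fin d) ℂ)
    (X Y : Fin d → Matrix (Fin d) (Fin d) ℂ) : ℝ :=
  (vNE (luders X ρ)
      - ∑ x ∈ Finset.univ.filter (fun x => 0 < ((X x * ρ).trace).re),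
          ((X x * ρ).trace).re * vNE ((((X x * ρ).trace).re)⁻¹ • (X x * ρ * X x)))
    - (vNE (luders Y (luders X ρ))
      - ∑ x ∈ Finset.univ.filter (fun x => 0 < ((X x * ρ).trace).re),
          ((X x * ρ).trace).re * vNE (luders Y ((((X x * ρ).trace).re)⁻¹ • (X x * ρ * X x))))

/-- for commuting rank-one PVMs `X, Y` on ℂ^d, the modified
context-incompatibility measure vanishes for every density matrix `ρ`:
`𝔦(ρ,X,Y) = 0`. -/
theorem stmt9 {d : ℕ}
    -- X is the rank-one PVM of an orthonormal basis (v x)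
    (v : Fin d → Fin d → ℂ)
    (hv : ∀ i j, (∑ k, star (v i k) * v j k) = if i = j then (1 : ℂ) else 0)
    (X : Fin d → Matrix (Fin d) (Fin d) ℂ)
    (hX : ∀ x, X x = Matrix.vecMulVec (v x) (star (v x)))
    -- Y is the rank-one PVM of an orthonormal basis (w j)
    (w : Fin d → Fin d → ℂ)
    (hw : ∀ i j, (∑ k, star (w i k) * w j k) = if i = j then (1 : ℂ) else 0)
    (Y : Fin d → Matrix (Fin d) (Fin d) ℂ)
    (hY : ∀ j, Y j = Matrix.vecMulVec (w j) (star (w j)))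
    -- the two PVMs commute
    (hcomm : ∀ x j, X x * Y j = Y j * X x)
    -- ρ is a density matrix
    (ρ : Matrix (Fin d) (Fin d) ℂ) (hρ : ρ.PosSemidef) (hρtr : ρ.trace = 1) :
    modIPC ρ X Y = 0 := by
  have hsum : ∑ j, Y j = 1 := by
    have h1 : (Matrix.of fun k j => w j k)ᴴ * (Matrix.of fun k j => w j k) = 1 := by
      ext i j
      simpa [Matrix.mul_apply, Matrix.one_apply] using hw i j
    have h2 := mul_eq_one_comm.mp h1
    rw [← h2]
    ext a b
    simp [Matrix.mul_apply, Matrix.sum_apply, hY, Matrix.vecMulVec_apply]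
  have hidem : ∀ j, Y j * Y j = Y j := by
    intro j
    have h := hw j j
    have h' : star (w j) ⬝ᵥ w j = 1 := by simpa [dotProduct] using h
    rw [hY, Matrix.vecMulVec_mul_vecMulVec, h', one_smul]
  have hfix : ∀ A, (∀ j, A * Y j = Y j * A) → luders Y A = A := by
    intro A hA
    unfold luders
    have : ∀ j, Y j * A * Y j = A * Y j := fun j => by
      rw [← hA j, Matrix.mul_assoc, hidem]
    simp_rw [this]
    rw [← Finset.mul_sum, hsum, Matrix.mul_one]
  have hXX : ∀ x, ∃ c : ℂ, X x * ρ * X x = c • X x := by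
    intro x
    refine ⟨(star (v x) ᵥ* ρ) ⬝ᵥ v x, ?_⟩
    rw [hX, Matrix.vecMulVec_mul, Matrix.vecMulVec_mul_vecMulVec]
    ext a b
    simp [Matrix.vecMulVec_apply]
    try ring
  have hc : ∀ x j, (X x * ρ * X x) * Y j = Y j * (X x * ρ * X x) := by
    intro x j
    obtain ⟨c, h⟩ := hXX x
    rw [h, Matrix.smul_mul, Matrix.mul_smul, hcomm]
  have e1 : luders Y (luders X ρ) = luders X ρ := by
    apply hfix
    intro j
    simp only [luders, Finset.sum_mul, Finset.mul_sum, hc]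
  have e2 : ∀ (r : ℝ) x, luders Y (r • (X x * ρ * X x)) = r • (X x * ρ * X x) := by
    intro r x
    apply hfix
    intro j
    rw [Matrix.smul_mul, Matrix.mul_smul, hc]
  unfold modIPC
  simp only [e1, e2, sub_self]
end

section
/- Let ρ_{AM} be a bipartite density matrix on ℂ^d ⊗ ℂ^m (a density matrix indexed by pairs in Fin d × Fin m), let Y = {Y_j} be a rank-one PVM on ℂ^d, and set ρ_{A′M} = ∑_j (Y_j ⊗ I_m) ρ_{AM} (Y_j ⊗ I_m). Let ρ_A = Tr_M ρ_{AM} and ρ_{A′} = Tr_M ρ_{A′M} be the partial traces over the second factor. Then the coherent information is non-increasing under the local Lüders measurement: S(ρ_{A′}) − S(ρ_{A′M}) ≤ S(ρ_A) − S(ρ_{AM}). Equivalently, ℐ_C − ℐ_C^{mem} = [S(ρ_{A′}) − S(ρ_A)] − [S(ρ_{A′M}) − S(ρ_{AM})] ≤ 0, i.e., the measure of Martins et al. does not decrease when memory is added, and 𝔦 − 𝔦^{mem} = [S(ρ_A) − S(ρ_{AM})] − [S(ρ_{A′}) − S(ρ_{A′M})] ≥ 0. -/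
open Matrix BigOperators Kronecker
open scoped ComplexOrder

/-- Partial trace over the second (memory) factor:
`(Tr_M ρ)(a,a') = ∑ μ, ρ((a,μ),(a',μ))`. -/
noncomputable def ptraceM {d m : ℕ} (ρ : Matrix (Fin d × Fin m) (Fin d × Fin m) ℂ) :
    Matrix (Fin d) (Fin d) ℂ :=
  Matrix.of fun a a' => ∑ μ, ρ (a, μ) (a', μ)

/-- Partial trace over the first factor: `(Tr_A ρ)(μ,ν) = ∑ a, ρ((a,μ),(a,ν))`. -/
noncomputable def ptraceA {d m : ℕ} (ρ : Matrix (Fin d × Fin m) (Fin d × Fin m) ℂ) :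
    Matrix (Fin m) (Fin m) ℂ :=
  Matrix.of fun μ ν => ∑ a, ρ (a, μ) (a, ν)


theorem aux_vNE_eq {n : Type*} [Fintype n] [DecidableEq n] (A U : Matrix n n ℂ) (μ : n → ℝ)
    (hU : Uᴴ * U = 1) (hA : A = U * diagonal (fun i => (μ i : ℂ)) * Uᴴ) :
    vNE A = -∑ i, μ i * Real.log (μ i) := by
  have hH : A.IsHermitian := by
    rw [hA]
    apply Matrix.isHermitian_mul_mul_conjTranspose
    apply Matrix.isHermitian_diagonal_of_self_adjoint
    ext i; simp
  have hc : A.charpoly = ∏ i, (Polynomial.X - Polynomial.C (μ i : ℂ)) := by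
    rw [hA, Matrix.charpoly_mul_comm, ← mul_assoc, hU, one_mul, Matrix.charpoly_diagonal]
  have h2 := hH.roots_charpoly_eq_eigenvalues
  have h3 : (∏ i, (Polynomial.X - Polynomial.C (μ i : ℂ))).roots =
      Multiset.map (fun i => (μ i : ℂ)) Finset.univ.val := by
    have := Polynomial.roots_multiset_prod_X_sub_C
      (Multiset.map (fun i => (μ i : ℂ)) (Finset.univ : Finset n).val)
    rw [Multiset.map_map] at this
    exact this
  rw [hc, h3] at h2
  have h4 := congrArg (fun S => (Multiset.map (fun z : ℂ => z.re * Real.log z.re) S).sum) h2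
  simp only [Multiset.map_map, Function.comp_apply, Complex.ofReal_re] at h4
  unfold vNE
  rw [dif_pos hH]
  exact congrArg Neg.neg h4.symm

theorem aux_exists_diag {n : Type*} [Fintype n] [DecidableEq n] (A : Matrix n n ℂ)
    (hA : A.PosSemidef) : ∃ (U : Matrix n n ℂ) (μ : n → ℝ), Uᴴ * U = 1 ∧ U * Uᴴ = 1 ∧
      A = U * diagonal (fun i => (μ i : ℂ)) * Uᴴ ∧ ∀ i, 0 ≤ μ i := by
  refine ⟨hA.1.eigenvectorUnitary, hA.1.eigenvalues, ?_, ?_, ?_, hA.eigenvalues_nonneg⟩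
  · exact Unitary.coe_star_mul_self _
  · exact Unitary.coe_mul_star_self _
  · exact hA.1.spectral_theorem

theorem aux_real {α β : Type*} [Fintype α] [Fintype β] (w r s : α → ℝ) (p q k : β → ℝ)
    (hr : ∀ a, 0 ≤ r a) (hs : ∀ a, 0 ≤ s a) (h0 : ∀ a, s a = 0 → w a * r a = 0)
    (hk : ∀ j, 0 ≤ k j) (hk0 : ∀ j, k j = 0 → p j = 0)
    (hsum : ∑ a, w a * r a = ∑ j, p j)
    (h : ∀ t : ℝ, 0 < t → ∑ j, (2 * (k j / (1 + t * k j)) * p j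
        - (k j / (1 + t * k j)) ^ 2 * (q j + t * p j)) ≤ ∑ a, w a * r a ^ 2 / (s a + t * r a)) :
    ∑ j, (p j * Real.log (k j) + p j - k j * q j) ≤
      ∑ a, w a * r a * Real.log (r a) - ∑ a, w a * r a * Real.log (s a) := by
  let F : ℝ → ℝ := fun T => ∑ a, w a * r a * Real.log (s a + T * r a)
    - ∑ j, (p j * Real.log (1 + T * k j) - p j / (1 + T * k j) + k j * q j / (1 + T * k j))
  let F' : ℝ → ℝ := fun T => ∑ a, w a * r a ^ 2 / (s a + T * r a)
    - ∑ j, (2 * (k j / (1 + T * k j)) * p j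
        - (k j / (1 + T * k j)) ^ 2 * (q j + T * p j))
  have hd : ∀ T, 0 ≤ T → HasDerivAt F (F' T) T := by
    intro T hT
    apply HasDerivAt.fun_sub
    · apply HasDerivAt.fun_sum
      intro a _
      by_cases hwr : w a * r a = 0
      · have : w a * r a ^ 2 / (s a + T * r a) = 0 := by rw [pow_two, ← mul_assoc, hwr]; simp
        rw [this]; simp only [hwr, zero_mul]; exact hasDerivAt_const _ _
      · have hs' : 0 < s a := lt_of_le_of_ne (hs a) (fun e => hwr (h0 a e.symm))
        have hpos : 0 < s a + T * r a := by have := mul_nonneg hT (hr a); linarith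
        have h1 : HasDerivAt (fun T : ℝ => s a + T * r a) (r a) T := by
          simpa using ((hasDerivAt_id T).mul_const (r a)).const_add (s a)
        refine ((h1.log hpos.ne').const_mul (w a * r a)).congr_deriv ?_
        ring
    · apply HasDerivAt.fun_sum
      intro j _
      have hpos : 0 < 1 + T * k j := by have := mul_nonneg hT (hk j); linarith
      have h1 : HasDerivAt (fun T : ℝ => 1 + T * k j) (k j) T := by
        simpa using ((hasDerivAt_id T).mul_const (k j)).const_add 1
      have h2 := ((h1.log hpos.ne').const_mul (p j))
      have h3 := (h1.fun_inv hpos.ne').const_mul (p j)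
      have h4 := (h1.fun_inv hpos.ne').const_mul (k j * q j)
      have h5 := (h2.fun_sub h3).fun_add h4
      simp only [div_eq_mul_inv] at h5 ⊢
      refine h5.congr_deriv ?_
      field_simp
      ring
  have hmono : MonotoneOn F (Set.Ici 0) := by
    apply monotoneOn_of_deriv_nonneg (convex_Ici 0)
    · intro T hT; exact (hd T hT).continuousAt.continuousWithinAt
    · intro T hT
      rw [interior_Ici] at hT
      exact (hd T (le_of_lt hT)).differentiableAt.differentiableWithinAt
    · intro T hT
      rw [interior_Ici] at hT
      rw [(hd T (le_of_lt hT)).deriv]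
      exact sub_nonneg.2 (h T hT)
  let G : ℝ → ℝ := fun u => ∑ a, w a * r a * Real.log (s a * u + r a)
    - ∑ j, (p j * Real.log (u + k j) - p j * (u / (u + k j)) + q j * (u * (k j / (u + k j))))
  have hG : ∀ u, 0 < u → F 0 ≤ G u := by
    intro u hu
    have h1 : F 0 ≤ F u⁻¹ := hmono (by simp) (by simp [hu.le]) (by positivity)
    have h2 : F u⁻¹ = G u := by
      have e1 : ∑ a, w a * r a * Real.log (s a + u⁻¹ * r a) =
          ∑ a, w a * r a * Real.log (s a * u + r a) - (∑ a, w a * r a) * Real.log u := by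
        rw [Finset.sum_mul, ← Finset.sum_sub_distrib]
        refine Finset.sum_congr rfl fun a _ => ?_
        by_cases hwr : w a * r a = 0
        · simp [hwr]
        have hs' : 0 < s a := lt_of_le_of_ne (hs a) (fun e => hwr (h0 a e.symm))
        have hpos : 0 < s a * u + r a := by have := mul_pos hs' hu; have := hr a; linarith
        rw [← mul_sub, ← Real.log_div hpos.ne' hu.ne']
        congr 2; field_simp
      have e2 : ∑ j, (p j * Real.log (1 + u⁻¹ * k j) - p j / (1 + u⁻¹ * k j)
            + k j * q j / (1 + u⁻¹ * k j)) =
          ∑ j, (p j * Real.log (u + k j) - p j * (u / (u + k j))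
            + q j * (u * (k j / (u + k j)))) - (∑ j, p j) * Real.log u := by
        rw [Finset.sum_mul, ← Finset.sum_sub_distrib]
        refine Finset.sum_congr rfl fun j _ => ?_
        have hpos : 0 < u + k j := by have := hk j; linarith
        have e3 : 1 + u⁻¹ * k j = (u + k j) / u := by field_simp
        rw [e3, Real.log_div hpos.ne' hu.ne']
        field_simp
        ring
      simp only [F, G]
      rw [e1, e2, hsum]; ring
    rw [← h2]; exact h1
  have hlim : Filter.Tendsto G (nhdsWithin 0 (Set.Ioi 0)) (nhds (∑ a, w a * r a * Real.log (r a)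
      - ∑ j, p j * Real.log (k j))) := by
    apply Filter.Tendsto.sub
    · apply tendsto_finsetSum
      intro a _
      by_cases hra : r a = 0
      · simp only [hra, mul_zero, zero_mul]; exact tendsto_const_nhds
      · have hc : ContinuousAt (fun u : ℝ => w a * r a * Real.log (s a * u + r a)) 0 := by
          apply ContinuousAt.mul continuousAt_const
          apply ContinuousAt.log (by fun_prop)
          simpa using hra
        have := hc.tendsto
        simp only [mul_zero, zero_add] at this
        exact this.mono_left nhdsWithin_le_nhds
    · apply tendsto_finsetSum
      intro j _
      by_cases hkj : k j = 0
      · simp only [hkj, hk0 j hkj, mul_zero, zero_mul, zero_div, sub_zero, add_zero]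
        exact tendsto_const_nhds
      · have hc : ContinuousAt (fun u : ℝ => p j * Real.log (u + k j) - p j * (u / (u + k j))
            + q j * (u * (k j / (u + k j)))) 0 := by
          have hne : (0 : ℝ) + k j ≠ 0 := by simpa using hkj
          have : ContinuousAt (fun u : ℝ => Real.log (u + k j)) 0 :=
            ContinuousAt.log (by fun_prop) hne
          fun_prop (disch := assumption)
        have := hc.tendsto
        simp only [zero_mul, zero_div, mul_zero, zero_add, sub_zero, add_zero] at this
        exact this.mono_left nhdsWithin_le_nhds
  have hfin := ge_of_tendsto hlim (Filter.eventually_of_mem self_mem_nhdsWithin hG)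
  simp only [F, zero_mul, add_zero, Real.log_one, mul_zero, div_one, zero_sub] at hfin
  simp only [Finset.sum_add_distrib, Finset.sum_sub_distrib, Finset.sum_neg_distrib] at hfin ⊢
  linarith

theorem aux_scalar (x y : ℂ) (r D : ℝ) (hD : 0 ≤ D) (hr : D = 0 → r = 0) :
    2 * r * (star y * x).re - Complex.normSq y * D ≤ Complex.normSq x * r ^ 2 / D := by
  rcases hD.eq_or_lt with h | h
  · rw [hr h.symm, ← h]; simp
  · rw [le_div_iff₀ h]
    simp only [Complex.normSq_apply, Complex.star_def, Complex.mul_re, Complex.conj_re,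
      Complex.conj_im]
    nlinarith [sq_nonneg (x.re * r - y.re * D), sq_nonneg (x.im * r - y.im * D)]

theorem aux_diag {n : Type*} [Fintype n] [DecidableEq n] (P : Matrix n n ℂ) (c : n → ℝ) (a : n) :
    (Pᴴ * diagonal (fun i => (c i : ℂ)) * P) a a = ((∑ j, c j * Complex.normSq (P j a) : ℝ) : ℂ) := by
  rw [Matrix.mul_apply]
  push_cast
  refine Finset.sum_congr rfl fun j _ => ?_
  rw [Matrix.mul_diagonal, Complex.normSq_eq_conj_mul_self, Matrix.conjTranspose_apply,
    Complex.star_def]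
  ring

theorem aux_diag' {n : Type*} [Fintype n] [DecidableEq n] (P : Matrix n n ℂ) (c : n → ℝ) (a : n) :
    (P * diagonal (fun i => (c i : ℂ)) * Pᴴ) a a = ((∑ j, c j * Complex.normSq (P a j) : ℝ) : ℂ) := by
  have := aux_diag Pᴴ c a
  simp only [Matrix.conjTranspose_conjTranspose] at this
  rw [this]
  simp [Matrix.conjTranspose_apply]

theorem aux_pointwise {n : Type*} [Fintype n] [DecidableEq n] (P Q : Matrix n n ℂ)
    (hP : P * Pᴴ = 1) (hQ : Q * Qᴴ = 1)
    (r s c : n → ℝ) (hr : ∀ a, 0 ≤ r a) (hs : ∀ a, 0 ≤ s a) (t : ℝ) (ht : 0 < t) :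
    ∑ j, (2 * c j * (∑ a, r a * Complex.normSq (P j a))
      - c j ^ 2 * ((∑ b, s b * Complex.normSq (Q j b))
        + t * (∑ a, r a * Complex.normSq (P j a)))) ≤
    ∑ x : n × n, Complex.normSq ((Qᴴ * P) x.1 x.2) * r x.2 ^ 2 / (s x.1 + t * r x.2) := by
  set M := Qᴴ * P with hM
  set C := diagonal (fun i => (c i : ℂ)) with hC
  have hCC : C * C = diagonal (fun i => ((c i ^ 2 : ℝ) : ℂ)) := by
    rw [hC, Matrix.diagonal_mul_diagonal]; congr 1; ext i; push_cast; ring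
  have hCh : Cᴴ = C := by
    rw [hC, Matrix.diagonal_conjTranspose]; congr 1; ext i; simp
  set Y := Qᴴ * C * P with hY
  have hYh : Yᴴ = Pᴴ * C * Q := by
    simp [hY, Matrix.conjTranspose_mul, hCh, mul_assoc]
  have h1 : Yᴴ * M = Pᴴ * C * P := by
    rw [hYh, hM]
    calc Pᴴ * C * Q * (Qᴴ * P) = Pᴴ * C * (Q * Qᴴ) * P := by simp only [mul_assoc]
      _ = _ := by rw [hQ, mul_one]
  have h2 : Yᴴ * Y = Pᴴ * diagonal (fun i => ((c i ^ 2 : ℝ) : ℂ)) * P := by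
    rw [hYh, hY, ← hCC]
    calc Pᴴ * C * Q * (Qᴴ * C * P) = Pᴴ * C * (Q * Qᴴ) * C * P := by simp only [mul_assoc]
      _ = _ := by rw [hQ, mul_one]; simp only [mul_assoc]
  have h3 : Y * Yᴴ = Qᴴ * diagonal (fun i => ((c i ^ 2 : ℝ) : ℂ)) * Q := by
    rw [hYh, hY, ← hCC]
    calc Qᴴ * C * P * (Pᴴ * C * Q) = Qᴴ * C * (P * Pᴴ) * C * Q := by simp only [mul_assoc]
      _ = _ := by rw [hP, mul_one]; simp only [mul_assoc]
  have k1 : ∀ a, ∑ b, (star (Y b a) * M b a).re = ∑ j, c j * Complex.normSq (P j a) := by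
    intro a
    have := congrArg Complex.re (congrFun (congrFun h1 a) a)
    rw [aux_diag, Matrix.mul_apply, Complex.re_sum, Complex.ofReal_re] at this
    simpa [Matrix.conjTranspose_apply] using this
  have k2 : ∀ a, ∑ b, Complex.normSq (Y b a) = ∑ j, c j ^ 2 * Complex.normSq (P j a) := by
    intro a
    have := congrArg Complex.re (congrFun (congrFun h2 a) a)
    rw [aux_diag, Matrix.mul_apply, Complex.re_sum, Complex.ofReal_re] at this
    rw [← this]
    refine Finset.sum_congr rfl fun b _ => ?_
    simp [Matrix.conjTranspose_apply, Complex.normSq_apply]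
  have k3 : ∀ b, ∑ a, Complex.normSq (Y b a) = ∑ j, c j ^ 2 * Complex.normSq (Q j b) := by
    intro b
    have := congrArg Complex.re (congrFun (congrFun h3 b) b)
    rw [aux_diag, Matrix.mul_apply, Complex.re_sum, Complex.ofReal_re] at this
    rw [← this]
    refine Finset.sum_congr rfl fun b _ => ?_
    simp [Matrix.conjTranspose_apply, Complex.normSq_apply]
  have hle : ∑ x : n × n, (2 * r x.2 * (star (Y x.1 x.2) * M x.1 x.2).re
      - Complex.normSq (Y x.1 x.2) * (s x.1 + t * r x.2)) ≤
      ∑ x : n × n, Complex.normSq (M x.1 x.2) * r x.2 ^ 2 / (s x.1 + t * r x.2) := by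
    refine Finset.sum_le_sum fun x _ => aux_scalar _ _ _ _ ?_ ?_
    · have := mul_nonneg ht.le (hr x.2); have := hs x.1; linarith
    · intro h
      have h1 := mul_nonneg ht.le (hr x.2); have h2 := hs x.1
      have h3 : t * r x.2 = 0 := by linarith
      exact (mul_eq_zero.1 h3).resolve_left ht.ne'
  refine le_trans (le_of_eq ?_) hle
  have e1 : ∑ x : n × n, 2 * r x.2 * (star (Y x.1 x.2) * M x.1 x.2).re
      = ∑ j, 2 * c j * (∑ a, r a * Complex.normSq (P j a)) := by
    rw [Fintype.sum_prod_type_right]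
    simp only [← Finset.mul_sum, k1]
    simp only [Finset.mul_sum]
    rw [Finset.sum_comm]
    refine Finset.sum_congr rfl fun _ _ => Finset.sum_congr rfl fun _ _ => by ring
  have e2 : ∑ x : n × n, Complex.normSq (Y x.1 x.2) * (t * r x.2)
      = ∑ j, c j ^ 2 * (t * ∑ a, r a * Complex.normSq (P j a)) := by
    rw [Fintype.sum_prod_type_right]
    simp only [← Finset.sum_mul, k2]
    simp only [Finset.mul_sum, Finset.sum_mul]
    rw [Finset.sum_comm]
    refine Finset.sum_congr rfl fun _ _ => Finset.sum_congr rfl fun _ _ => by ring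
  have e3 : ∑ x : n × n, Complex.normSq (Y x.1 x.2) * s x.1
      = ∑ j, c j ^ 2 * (∑ a, s a * Complex.normSq (Q j a)) := by
    rw [Fintype.sum_prod_type]
    simp only [← Finset.sum_mul, k3]
    simp only [Finset.mul_sum, Finset.sum_mul]
    rw [Finset.sum_comm]
    refine Finset.sum_congr rfl fun _ _ => Finset.sum_congr rfl fun _ _ => by ring
  simp only [mul_add, Finset.sum_sub_distrib, Finset.sum_add_distrib, e1, e2, e3]

theorem aux_main {n : Type*} [Fintype n] [DecidableEq n] (ρ U V W : Matrix n n ℂ)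
    (hU : U * Uᴴ = 1) (hU' : Uᴴ * U = 1) (hV : V * Vᴴ = 1) (hV' : Vᴴ * V = 1)
    (hW : W * Wᴴ = 1) (hW' : Wᴴ * W = 1)
    (r s p q k g : n → ℝ) (hρ : ρ = U * diagonal (fun i => (r i : ℂ)) * Uᴴ)
    (hr : ∀ a, 0 ≤ r a) (hs : ∀ a, 0 ≤ s a)
    (hp : ∀ j, (Wᴴ * ρ * W) j j = (p j : ℂ))
    (hg : ∀ j, (Vᴴ * ρ * V) j j = (g j : ℂ))
    (hq : ∀ j, (Wᴴ * (V * diagonal (fun i => (s i : ℂ)) * Vᴴ) * W) j j = (q j : ℂ))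
    (hk : ∀ j, 0 ≤ k j) (hk0 : ∀ j, k j = 0 → p j = 0) (hs0 : ∀ b, s b = 0 → g b = 0) :
    ∑ j, (p j * Real.log (k j) + p j - k j * q j) ≤
      ∑ a, r a * Real.log (r a) - ∑ b, g b * Real.log (s b) := by
  have hp' : ∀ j, p j = ∑ a, r a * Complex.normSq ((Wᴴ * U) j a) := by
    intro j
    have := hp j
    rw [hρ, show Wᴴ * (U * diagonal (fun i => (r i : ℂ)) * Uᴴ) * W
      = (Wᴴ * U) * diagonal (fun i => (r i : ℂ)) * (Wᴴ * U)ᴴ by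
        simp [Matrix.conjTranspose_mul, mul_assoc], aux_diag'] at this
    exact_mod_cast this.symm
  have hg' : ∀ j, g j = ∑ a, r a * Complex.normSq ((Vᴴ * U) j a) := by
    intro j
    have := hg j
    rw [hρ, show Vᴴ * (U * diagonal (fun i => (r i : ℂ)) * Uᴴ) * V
      = (Vᴴ * U) * diagonal (fun i => (r i : ℂ)) * (Vᴴ * U)ᴴ by
        simp [Matrix.conjTranspose_mul, mul_assoc], aux_diag'] at this
    exact_mod_cast this.symm
  have hq' : ∀ j, q j = ∑ a, s a * Complex.normSq ((Wᴴ * V) j a) := by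
    intro j
    have := hq j
    rw [show Wᴴ * (V * diagonal (fun i => (s i : ℂ)) * Vᴴ) * W
      = (Wᴴ * V) * diagonal (fun i => (s i : ℂ)) * (Wᴴ * V)ᴴ by
        simp [Matrix.conjTranspose_mul, mul_assoc], aux_diag'] at this
    exact_mod_cast this.symm
  have hP : (Wᴴ * U) * (Wᴴ * U)ᴴ = 1 := by
    rw [Matrix.conjTranspose_mul, Matrix.conjTranspose_conjTranspose]
    calc Wᴴ * U * (Uᴴ * W) = Wᴴ * (U * Uᴴ) * W := by simp only [mul_assoc]
      _ = 1 := by rw [hU, mul_one, hW']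
  have hQ : (Wᴴ * V) * (Wᴴ * V)ᴴ = 1 := by
    rw [Matrix.conjTranspose_mul, Matrix.conjTranspose_conjTranspose]
    calc Wᴴ * V * (Vᴴ * W) = Wᴴ * (V * Vᴴ) * W := by simp only [mul_assoc]
      _ = 1 := by rw [hV, mul_one, hW']
  have hM : (Wᴴ * V)ᴴ * (Wᴴ * U) = Vᴴ * U := by
    rw [Matrix.conjTranspose_mul, Matrix.conjTranspose_conjTranspose]
    calc Vᴴ * W * (Wᴴ * U) = Vᴴ * (W * Wᴴ) * U := by simp only [mul_assoc]
      _ = _ := by rw [hW, mul_one]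
  have hcol : ∀ a, ∑ b, Complex.normSq ((Vᴴ * U) b a) = 1 := by
    intro a
    have h1 : (Vᴴ * U)ᴴ * diagonal (fun _ => ((1 : ℝ) : ℂ)) * (Vᴴ * U) = 1 := by
      rw [show diagonal (fun _ : n => ((1 : ℝ) : ℂ)) = 1 by simp, mul_one,
        Matrix.conjTranspose_mul, Matrix.conjTranspose_conjTranspose]
      calc Uᴴ * V * (Vᴴ * U) = Uᴴ * (V * Vᴴ) * U := by simp only [mul_assoc]
        _ = 1 := by rw [hV, mul_one, hU']
    have h2 := aux_diag (Vᴴ * U) (fun _ => 1) a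
    rw [h1, Matrix.one_apply_eq] at h2
    simp only [one_mul] at h2
    exact_mod_cast h2.symm
  have hsumr : ∀ f : n → ℝ, ∑ x : n × n, Complex.normSq ((Vᴴ * U) x.1 x.2) * r x.2 * f x.2
      = ∑ a, r a * f a := by
    intro f
    rw [Fintype.sum_prod_type_right]
    refine Finset.sum_congr rfl fun a _ => ?_
    simp only [mul_assoc, ← Finset.sum_mul, hcol, one_mul]
  have hsumg : ∀ f : n → ℝ, ∑ x : n × n, Complex.normSq ((Vᴴ * U) x.1 x.2) * r x.2 * f x.1
      = ∑ b, g b * f b := by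
    intro f
    rw [Fintype.sum_prod_type]
    refine Finset.sum_congr rfl fun a _ => ?_
    dsimp only
    rw [← Finset.sum_mul, hg']
    congr 1
    exact Finset.sum_congr rfl fun _ _ => mul_comm _ _
  have hrow : ∀ a, ∑ j, Complex.normSq ((Wᴴ * U) j a) = 1 := by
    intro a
    have h1 : (Wᴴ * U)ᴴ * diagonal (fun _ => ((1 : ℝ) : ℂ)) * (Wᴴ * U) = 1 := by
      rw [show diagonal (fun _ : n => ((1 : ℝ) : ℂ)) = 1 by simp, mul_one,
        Matrix.conjTranspose_mul, Matrix.conjTranspose_conjTranspose]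
      calc Uᴴ * W * (Wᴴ * U) = Uᴴ * (W * Wᴴ) * U := by simp only [mul_assoc]
        _ = 1 := by rw [hW, mul_one, hU']
    have h2 := aux_diag (Wᴴ * U) (fun _ => 1) a
    rw [h1, Matrix.one_apply_eq] at h2
    simp only [one_mul] at h2
    exact_mod_cast h2.symm
  have key := aux_real (α := n × n) (β := n)
    (fun x => Complex.normSq ((Vᴴ * U) x.1 x.2)) (fun x => r x.2) (fun x => s x.1) p q k
    (fun x => hr _) (fun x => hs _) ?_ hk hk0 ?_ ?_
  · rw [hsumr (fun a => Real.log (r a)), hsumg (fun b => Real.log (s b))] at key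
    exact key
  · rintro ⟨b, a⟩ hb
    have h1 := hs0 b hb
    rw [hg', Finset.sum_eq_zero_iff_of_nonneg
      (fun i _ => mul_nonneg (hr i) (Complex.normSq_nonneg _))] at h1
    have := h1 a (Finset.mem_univ _)
    simpa [mul_comm] using this
  · have := hsumr (fun _ => 1)
    simp only [mul_one] at this
    rw [this]
    simp only [hp']
    rw [Finset.sum_comm]
    refine Finset.sum_congr rfl fun a _ => ?_
    rw [← Finset.mul_sum, hrow, mul_one]
  · intro t ht
    have := aux_pointwise (Wᴴ * U) (Wᴴ * V) hP hQ r s (fun j => k j / (1 + t * k j)) hr hs t ht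
    rw [hM] at this
    simpa only [← hp', ← hq'] using this

theorem aux_pt_conj {d m : ℕ} (B C : Matrix (Fin d) (Fin d) ℂ)
    (X : Matrix (Fin d × Fin m) (Fin d × Fin m) ℂ) :
    ptraceM ((B ⊗ₖ (1 : Matrix (Fin m) (Fin m) ℂ)) * X * (C ⊗ₖ (1 : Matrix (Fin m) (Fin m) ℂ)))
      = B * ptraceM X * C := by
  ext a b
  simp only [ptraceM, Matrix.of_apply, Matrix.mul_apply, Fintype.sum_prod_type,
    Matrix.kroneckerMap_apply, Matrix.one_apply, mul_ite, mul_one, mul_zero, ite_mul, zero_mul,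
    Finset.sum_ite_eq, Finset.sum_ite_eq', Finset.mem_univ, if_true, Finset.mul_sum,
    Finset.sum_mul]
  rw [Finset.sum_comm]
  refine Finset.sum_congr rfl fun x _ => ?_
  rw [Finset.sum_comm]

theorem aux_pt_psd {d m : ℕ} (X : Matrix (Fin d × Fin m) (Fin d × Fin m) ℂ) (hX : X.PosSemidef) :
    (ptraceM X).PosSemidef := by
  have : ptraceM X = ∑ μ : Fin m, X.submatrix (fun a => (a, μ)) (fun a => (a, μ)) := by
    ext a b
    simp [ptraceM, Matrix.sum_apply]
  rw [this]
  exact Matrix.posSemidef_sum _ fun μ _ => hX.submatrix _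

/-- block diagonal matrix -/
def auxBd {d m : ℕ} (F : Fin d → Matrix (Fin m) (Fin m) ℂ) :
    Matrix (Fin d × Fin m) (Fin d × Fin m) ℂ :=
  Matrix.of fun x y => if x.1 = y.1 then F x.1 x.2 y.2 else 0

theorem auxBd_mul {d m : ℕ} (F G : Fin d → Matrix (Fin m) (Fin m) ℂ) :
    auxBd F * auxBd G = auxBd (fun j => F j * G j) := by
  ext ⟨i, a⟩ ⟨j, b⟩
  simp only [auxBd, Matrix.mul_apply, Matrix.of_apply, Fintype.sum_prod_type]
  rw [Finset.sum_eq_single i]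
  · by_cases h : i = j <;> simp [h]
  · intro k _ hk; simp [Ne.symm hk]
  · simp

theorem auxBd_conjTranspose {d m : ℕ} (F : Fin d → Matrix (Fin m) (Fin m) ℂ) :
    (auxBd F)ᴴ = auxBd (fun j => (F j)ᴴ) := by
  ext ⟨i, a⟩ ⟨j, b⟩
  by_cases h : i = j
  · subst h; simp [auxBd, Matrix.conjTranspose_apply]
  · simp [auxBd, Matrix.conjTranspose_apply, h, Ne.symm h]

theorem auxBd_one {d m : ℕ} :
    auxBd (fun _ : Fin d => (1 : Matrix (Fin m) (Fin m) ℂ)) = 1 := by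
  ext ⟨i, a⟩ ⟨j, b⟩
  by_cases h : i = j <;> simp [auxBd, Matrix.one_apply, h]

theorem auxBd_diagonal {d m : ℕ} (l : Fin d → Fin m → ℂ) :
    auxBd (fun j => diagonal (l j)) = diagonal (fun x => l x.1 x.2) := by
  ext ⟨i, a⟩ ⟨j, b⟩
  by_cases h : i = j <;> simp [auxBd, Matrix.diagonal_apply, h]

theorem aux_conj_bd {d m : ℕ} (F : Fin d → Matrix (Fin m) (Fin m) ℂ)
    (X : Matrix (Fin d × Fin m) (Fin d × Fin m) ℂ) (j : Fin d) (n : Fin m) :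
    ((auxBd F)ᴴ * X * auxBd F) (j, n) (j, n) =
      ((F j)ᴴ * X.submatrix (fun a => (j, a)) (fun a => (j, a)) * F j) n n := by
  rw [auxBd_conjTranspose]
  simp [auxBd, Matrix.mul_apply, Fintype.sum_prod_type, Finset.sum_ite_eq, ite_mul, mul_ite,
    Finset.sum_mul]

theorem aux_single {d m : ℕ} (R : Matrix (Fin d × Fin m) (Fin d × Fin m) ℂ) :
    ∑ j, (Matrix.single j j (1 : ℂ) ⊗ₖ (1 : Matrix (Fin m) (Fin m) ℂ)) * R *
      (Matrix.single j j (1 : ℂ) ⊗ₖ (1 : Matrix (Fin m) (Fin m) ℂ)) =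
    auxBd (fun j => R.submatrix (fun a => (j, a)) (fun a => (j, a))) := by
  have hs : ∀ j : Fin d, (Matrix.single j j (1 : ℂ) ⊗ₖ (1 : Matrix (Fin m) (Fin m) ℂ)) =
      diagonal (fun x => if x.1 = j then 1 else 0) := by
    intro j
    ext ⟨a, x⟩ ⟨b, y⟩
    simp only [Matrix.kroneckerMap_apply, Matrix.single_apply, Matrix.one_apply,
      Matrix.diagonal_apply, Prod.mk.injEq]
    grind
  ext ⟨a, x⟩ ⟨b, y⟩
  simp only [hs, Matrix.sum_apply, Matrix.mul_diagonal, Matrix.diagonal_mul, auxBd,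
    Matrix.of_apply, Matrix.submatrix_apply]
  rw [Finset.sum_eq_single a]
  · by_cases h : a = b
    · simp [h]
    · simp [h, Ne.symm h]
  · intro k _ hk; simp [Ne.symm hk]
  · simp

theorem aux_core {d m : ℕ} (ρ : Matrix (Fin d × Fin m) (Fin d × Fin m) ℂ) (hρ : ρ.PosSemidef)
    (B : Matrix (Fin d) (Fin d) ℂ) (hB : Bᴴ * B = 1) (Y : Fin d → Matrix (Fin d) (Fin d) ℂ)
    (hY : ∀ j, Y j = B * Matrix.single j j 1 * Bᴴ)
    (ρ' : Matrix (Fin d × Fin m) (Fin d × Fin m) ℂ)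
    (hρ' : ρ' = ∑ j, (Y j ⊗ₖ (1 : Matrix (Fin m) (Fin m) ℂ)) * ρ *
      (Y j ⊗ₖ (1 : Matrix (Fin m) (Fin m) ℂ))) :
    vNE (ptraceM ρ') - vNE ρ' ≤ vNE (ptraceM ρ) - vNE ρ := by
  have hB' : B * Bᴴ = 1 := mul_eq_one_comm.1 hB
  set K := B ⊗ₖ (1 : Matrix (Fin m) (Fin m) ℂ) with hK
  have hKh : Kᴴ = Bᴴ ⊗ₖ (1 : Matrix (Fin m) (Fin m) ℂ) := by
    rw [hK, Matrix.conjTranspose_kronecker, Matrix.conjTranspose_one]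
  have hK1 : Kᴴ * K = 1 := by
    rw [hKh, hK, ← Matrix.mul_kronecker_mul, hB, one_mul, Matrix.one_kronecker_one]
  have hK2 : K * Kᴴ = 1 := mul_eq_one_comm.1 hK1
  set R := Kᴴ * ρ * K with hR
  have hRpsd : R.PosSemidef := hρ.conjTranspose_mul_mul_same K
  set Rb : Fin d → Matrix (Fin m) (Fin m) ℂ :=
    fun j => R.submatrix (fun a => (j, a)) (fun a => (j, a)) with hRb
  have hRbpsd : ∀ j, (Rb j).PosSemidef := fun j => hRpsd.submatrix _
  choose F l hF1 hF2 hF hl using fun j => aux_exists_diag (Rb j) (hRbpsd j)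
  obtain ⟨U, r, hU1, hU2, hU, hr⟩ := aux_exists_diag ρ hρ
  obtain ⟨A, α, hA1, hA2, hA, hα⟩ := aux_exists_diag (ptraceM ρ) (aux_pt_psd ρ hρ)
  -- the post-measurement state
  have hρ'1 : ρ' = K * auxBd Rb * Kᴴ := by
    rw [hρ', hRb, ← aux_single, Finset.mul_sum, Finset.sum_mul]
    refine Finset.sum_congr rfl fun j _ => ?_
    have e : Y j ⊗ₖ (1 : Matrix (Fin m) (Fin m) ℂ) =
        K * (Matrix.single j j (1 : ℂ) ⊗ₖ (1 : Matrix (Fin m) (Fin m) ℂ)) * Kᴴ := by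
      rw [hKh, hK, ← Matrix.mul_kronecker_mul, ← Matrix.mul_kronecker_mul, hY, one_mul, one_mul]
    rw [e, hR]
    simp only [mul_assoc]
  set W := K * auxBd F with hW
  have hG1 : (auxBd F)ᴴ * auxBd F = 1 := by
    rw [auxBd_conjTranspose, auxBd_mul]; simp only [hF1]; exact auxBd_one
  have hWh : Wᴴ = (auxBd F)ᴴ * Kᴴ := by rw [hW, Matrix.conjTranspose_mul]
  have hW1 : Wᴴ * W = 1 := by
    rw [hWh, hW]
    calc (auxBd F)ᴴ * Kᴴ * (K * auxBd F) = (auxBd F)ᴴ * (Kᴴ * K) * auxBd F := by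
          simp only [mul_assoc]
      _ = 1 := by rw [hK1, mul_one, hG1]
  have hW2 : W * Wᴴ = 1 := mul_eq_one_comm.1 hW1
  have hρ'2 : ρ' = W * diagonal (fun x : Fin d × Fin m => ((l x.1 x.2 : ℝ) : ℂ)) * Wᴴ := by
    have e : auxBd Rb = auxBd F * diagonal (fun x : Fin d × Fin m => ((l x.1 x.2 : ℝ) : ℂ))
        * (auxBd F)ᴴ := by
      rw [← auxBd_diagonal (fun j n => ((l j n : ℝ) : ℂ)), auxBd_conjTranspose, auxBd_mul,
        auxBd_mul]
      congr 1
      funext j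
      exact hF j
    rw [hρ'1, e, hWh, hW]
    simp only [mul_assoc]
  have S1 := aux_vNE_eq ρ' W (fun x => l x.1 x.2) hW1 hρ'2
  set π : Fin d → ℝ := fun j => ∑ n, l j n with hπ
  have htr : ∀ j, ∑ n, R (j, n) (j, n) = (π j : ℂ) := by
    intro j
    have : (Rb j).trace = (π j : ℂ) := by
      rw [hF j, Matrix.trace_mul_comm, ← mul_assoc, hF1, one_mul, Matrix.trace_diagonal, hπ]
      push_cast; rfl
    exact this
  have hpt' : ptraceM ρ' = B * diagonal (fun j => (π j : ℂ)) * Bᴴ := by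
    rw [hρ'1, hKh, hK, aux_pt_conj]
    congr 2
    ext i j
    by_cases h : i = j
    · subst h
      simp only [ptraceM, Matrix.of_apply, auxBd, if_true, Matrix.diagonal_apply_eq, ← htr, hRb,
        Matrix.submatrix_apply]
    · simp [ptraceM, auxBd, h]
  have S2 := aux_vNE_eq _ B π hB hpt'
  have S3 := aux_vNE_eq ρ U r hU1 hU
  have S4 := aux_vNE_eq _ A α hA1 hA
  set V := A ⊗ₖ (1 : Matrix (Fin m) (Fin m) ℂ) with hV
  have hVh : Vᴴ = Aᴴ ⊗ₖ (1 : Matrix (Fin m) (Fin m) ℂ) := by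
    rw [hV, Matrix.conjTranspose_kronecker, Matrix.conjTranspose_one]
  have hV1 : Vᴴ * V = 1 := by
    rw [hVh, hV, ← Matrix.mul_kronecker_mul, hA1, one_mul, Matrix.one_kronecker_one]
  have hV2 : V * Vᴴ = 1 := mul_eq_one_comm.1 hV1
  have hVpsd : (Vᴴ * ρ * V).PosSemidef := hρ.conjTranspose_mul_mul_same V
  set g : Fin d × Fin m → ℝ := fun x => ((Vᴴ * ρ * V) x x).re with hg
  have hg0 : ∀ x, 0 ≤ g x := fun x => (Complex.nonneg_iff.1 hVpsd.diag_nonneg).1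
  have hg1 : ∀ x, (Vᴴ * ρ * V) x x = (g x : ℂ) := by
    intro x
    apply Complex.ext
    · simp [hg]
    · have := (Complex.nonneg_iff.1 (hVpsd.diag_nonneg (i := x))).2
      rw [← this]; simp
  have hgs : ∀ i, ∑ n, g (i, n) = α i := by
    intro i
    have h1 : ptraceM (Vᴴ * ρ * V) = diagonal (fun i => (α i : ℂ)) := by
      rw [hVh, hV, aux_pt_conj, hA]
      calc Aᴴ * (A * diagonal (fun i => (α i : ℂ)) * Aᴴ) * A
          = (Aᴴ * A) * diagonal (fun i => (α i : ℂ)) * (Aᴴ * A) := by simp only [mul_assoc]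
        _ = _ := by rw [hA1, one_mul, mul_one]
    have h2 := congrFun (congrFun h1 i) i
    simp only [ptraceM, Matrix.of_apply, hg1, Matrix.diagonal_apply_eq] at h2
    exact_mod_cast h2
  have hσ : V * diagonal (fun x : Fin d × Fin m => (α x.1 : ℂ)) * Vᴴ =
      ptraceM ρ ⊗ₖ (1 : Matrix (Fin m) (Fin m) ℂ) := by
    have e : diagonal (fun x : Fin d × Fin m => (α x.1 : ℂ)) =
        diagonal (fun i => (α i : ℂ)) ⊗ₖ (1 : Matrix (Fin m) (Fin m) ℂ) := by
      rw [← Matrix.diagonal_one, Matrix.diagonal_kronecker_diagonal]; simp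
    rw [e, hVh, hV, ← Matrix.mul_kronecker_mul, ← Matrix.mul_kronecker_mul, one_mul, one_mul, ← hA]
  have hp : ∀ x : Fin d × Fin m, (Wᴴ * ρ * W) x x = (l x.1 x.2 : ℂ) := by
    rintro ⟨j, n⟩
    have e : Wᴴ * ρ * W = (auxBd F)ᴴ * R * auxBd F := by
      rw [hWh, hW, hR]; simp only [mul_assoc]
    rw [e, aux_conj_bd]
    change ((F j)ᴴ * Rb j * F j) n n = _
    have e2 : (F j)ᴴ * Rb j * F j = diagonal (fun i => (l j i : ℂ)) := by
      rw [hF j]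
      calc (F j)ᴴ * (F j * diagonal (fun i => (l j i : ℂ)) * (F j)ᴴ) * F j
          = ((F j)ᴴ * F j) * diagonal (fun i => (l j i : ℂ)) * ((F j)ᴴ * F j) := by
            simp only [mul_assoc]
        _ = _ := by rw [hF1, one_mul, mul_one]
    rw [e2, Matrix.diagonal_apply_eq]
  have hBA : ∀ j, (Bᴴ * ptraceM ρ * B) j j = (π j : ℂ) := by
    intro j
    have : ptraceM R = Bᴴ * ptraceM ρ * B := by rw [hR, hKh, hK, aux_pt_conj]
    rw [← this, ← htr]
    rfl
  have hq : ∀ x : Fin d × Fin m,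
      (Wᴴ * (V * diagonal (fun x : Fin d × Fin m => (α x.1 : ℂ)) * Vᴴ) * W) x x = (π x.1 : ℂ) := by
    rintro ⟨j, n⟩
    rw [hσ]
    have e : Wᴴ * (ptraceM ρ ⊗ₖ (1 : Matrix (Fin m) (Fin m) ℂ)) * W =
        (auxBd F)ᴴ * ((Bᴴ * ptraceM ρ * B) ⊗ₖ (1 : Matrix (Fin m) (Fin m) ℂ)) * auxBd F := by
      have : (Bᴴ * ptraceM ρ * B) ⊗ₖ (1 : Matrix (Fin m) (Fin m) ℂ) =
          Kᴴ * (ptraceM ρ ⊗ₖ (1 : Matrix (Fin m) (Fin m) ℂ)) * K := by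
        rw [hKh, hK, ← Matrix.mul_kronecker_mul, ← Matrix.mul_kronecker_mul, one_mul, one_mul]
      rw [this, hWh, hW]; simp only [mul_assoc]
    rw [e, aux_conj_bd]
    have e2 : ((Bᴴ * ptraceM ρ * B) ⊗ₖ (1 : Matrix (Fin m) (Fin m) ℂ)).submatrix
        (fun a => (j, a)) (fun a => (j, a)) = (π j : ℂ) • (1 : Matrix (Fin m) (Fin m) ℂ) := by
      ext a b
      simp only [Matrix.submatrix_apply, Matrix.kroneckerMap_apply, hBA, Matrix.smul_apply,
        smul_eq_mul]
    rw [e2]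
    simp [hF1]
  have hπ0 : ∀ j, 0 ≤ π j := fun j => Finset.sum_nonneg fun n _ => hl j n
  have hlπ : ∀ j n, π j = 0 → l j n = 0 := by
    intro j n h
    exact (Finset.sum_eq_zero_iff_of_nonneg (fun i _ => hl j i)).1 h n (Finset.mem_univ _)
  have key := aux_main ρ U V W hU2 hU1 hV2 hV1 hW2 hW1 r (fun x => α x.1) (fun x => l x.1 x.2)
    (fun x => π x.1) (fun x => l x.1 x.2 / π x.1) g hU hr (fun x => hα _) hp hg1 hq
    (fun x => div_nonneg (hl _ _) (hπ0 _)) ?_ ?_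
  · have e1 : ∑ x : Fin d × Fin m, g x * Real.log (α x.1) = ∑ i, α i * Real.log (α i) := by
      rw [Fintype.sum_prod_type]
      refine Finset.sum_congr rfl fun i _ => ?_
      dsimp only
      rw [← Finset.sum_mul, hgs]
    have e2 : ∑ x : Fin d × Fin m, l x.1 x.2 * Real.log (π x.1) = ∑ j, π j * Real.log (π j) := by
      rw [Fintype.sum_prod_type]
      refine Finset.sum_congr rfl fun i _ => ?_
      dsimp only
      rw [← Finset.sum_mul]
    have e3 : ∑ x : Fin d × Fin m, (l x.1 x.2 * Real.log (l x.1 x.2 / π x.1) + l x.1 x.2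
        - l x.1 x.2 / π x.1 * π x.1) = ∑ x : Fin d × Fin m, l x.1 x.2 * Real.log (l x.1 x.2)
        - ∑ x : Fin d × Fin m, l x.1 x.2 * Real.log (π x.1) := by
      rw [← Finset.sum_sub_distrib]
      refine Finset.sum_congr rfl fun x _ => ?_
      by_cases h : l x.1 x.2 = 0
      · simp [h]
      · have hp : π x.1 ≠ 0 := fun e => h (hlπ _ _ e)
        rw [Real.log_div h hp, div_mul_cancel₀ _ hp]
        ring
    rw [e1, e3, e2] at key
    rw [S1, S2, S3, S4]
    linarith
  · intro x hx
    rcases div_eq_zero_iff.1 hx with h | h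
    · exact h
    · exact hlπ _ _ h
  · rintro ⟨i, n⟩ h
    have h' : ∑ n, g (i, n) = 0 := by rw [hgs]; exact h
    exact (Finset.sum_eq_zero_iff_of_nonneg (fun n _ => hg0 (i, n))).1 h' n (Finset.mem_univ _)

/-- the coherent information `I^coh(M⟩A) = S(Tr_M ρ_AM) - S(ρ_AM)` is
non-increasing under a local Lüders measurement of a rank-one PVM `Y` on the `A` part:
`S(ρ_{A'}) - S(ρ_{A'M}) ≤ S(ρ_A) - S(ρ_AM)`; equivalently
`ℐ_C - ℐ_C^mem = [S(ρ_{A'}) - S(ρ_A)] - [S(ρ_{A'M}) - S(ρ_AM)] ≤ 0` and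
`𝔦 - 𝔦^mem = [S(ρ_A) - S(ρ_AM)] - [S(ρ_{A'}) - S(ρ_{A'M})] ≥ 0`. -/
theorem stmt12 {d m : ℕ}
    -- ρ_AM is a bipartite density matrix on ℂ^d ⊗ ℂ^m
    (ρAM : Matrix (Fin d × Fin m) (Fin d × Fin m) ℂ)
    (hρ : ρAM.PosSemidef) (hρtr : ρAM.trace = 1)
    -- Y is a rank-one PVM on ℂ^d
    (w : Fin d → Fin d → ℂ)
    (hw : ∀ i j, (∑ k, star (w i k) * w j k) = if i = j then (1 : ℂ) else 0)
    (Y : Fin d → Matrix (Fin d) (Fin d) ℂ)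
    (hY : ∀ j, Y j = Matrix.vecMulVec (w j) (star (w j)))
    -- ρ_{A'M} is the post-measurement bipartite state
    (ρA'M : Matrix (Fin d × Fin m) (Fin d × Fin m) ℂ)
    (hA' : ρA'M = ∑ j, (Y j ⊗ₖ (1 : Matrix (Fin m) (Fin m) ℂ)) * ρAM *
      (Y j ⊗ₖ (1 : Matrix (Fin m) (Fin m) ℂ))) :
    (vNE (ptraceM ρA'M) - vNE ρA'M ≤ vNE (ptraceM ρAM) - vNE ρAM) ∧
    ((vNE (ptraceM ρA'M) - vNE (ptraceM ρAM)) - (vNE ρA'M - vNE ρAM) ≤ 0) ∧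
    ((vNE (ptraceM ρAM) - vNE ρAM) - (vNE (ptraceM ρA'M) - vNE ρA'M) ≥ 0) := by
  have core : vNE (ptraceM ρA'M) - vNE ρA'M ≤ vNE (ptraceM ρAM) - vNE ρAM := by
    refine aux_core ρAM hρ (Matrix.of fun a j => w j a) ?_ Y ?_ ρA'M hA'
    · ext i j
      rw [Matrix.mul_apply, Matrix.one_apply, ← hw i j]
      rfl
    · intro j
      ext a b
      rw [hY, Matrix.mul_assoc, Matrix.mul_apply]
      simp [Matrix.vecMulVec_apply, Matrix.single_apply, Matrix.mul_apply, ite_and]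
  refine ⟨core, ?_, ?_⟩ <;> linarith
end
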